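/- arXiv:1512.07077 — 4 statements merged into one kernel-verified Lean document; each statement's English description precedes it below -/
import Mathlib

section
/- Let P be a homogeneous polynomial of degree p on ℝⁿ and a ∈ ℝⁿ \ ℤⁿ. Then the function f_a(s) = ∑_{k ∈ ℤⁿ, k ≠ 0} P(k) e^{2πi k·a} / ‖k‖^s, initially defined and holomorphic for Re(s) > n + p, extends to an entire function on ℂ. -/
open Complex


lemma te_hasDerivAt_iter (f f' : ℝ → ℂ) (N : ℕ) (y : ℝ)
    (h : ∀ j : ℕ, j ≤ N → HasDerivAt f (f' (y + j)) (y + j)) :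
    HasDerivAt ((fwdDiff (1:ℝ))^[N] f) ((fwdDiff (1:ℝ))^[N] f' y) y := by
  have e : (fwdDiff (1:ℝ))^[N] f = fun y => ∑ k ∈ Finset.range (N + 1),
      ((-1 : ℤ) ^ (N - k) * N.choose k) • f (y + k • (1:ℝ)) := by
    funext y; exact fwdDiff_iter_eq_sum_shift _ _ _ _
  rw [e, fwdDiff_iter_eq_sum_shift]
  apply HasDerivAt.fun_sum
  intro k hk
  have hk' : k ≤ N := by simpa [Nat.lt_succ_iff] using hk
  have := (h k hk').comp_add_const y k
  simp only [nsmul_eq_mul, mul_one]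
  simp only [zsmul_eq_mul]
  exact this.const_mul _

noncomputable def teG (α : ℕ) (s : ℂ) (q : ℝ) (y : ℝ) : ℂ :=
  (y:ℂ)^α * ((y^2+q : ℝ):ℂ)^(-s/2)

lemma te_hasDerivAt_G (α : ℕ) (s : ℂ) (q y : ℝ) (h : 0 < y^2+q) :
    HasDerivAt (teG α s q) (((α:ℂ) • teG (α-1) s q + (-s) • teG (α+1) (s+2) q) y) y := by
  have h0 : ((y^2+q : ℝ):ℂ) ≠ 0 := by exact_mod_cast h.ne'
  have h1 : HasDerivAt (fun z : ℂ => z^α * (z^2+q)^(-s/2))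
      (((α:ℂ) • teG (α-1) s q + (-s) • teG (α+1) (s+2) q) y) (y:ℂ) := by
    have hb : HasDerivAt (fun z : ℂ => z^2 + q) (2*y) (y:ℂ) := by
      simpa using (hasDerivAt_pow 2 (y:ℂ)).add_const (q:ℂ)
    have hs : ((y:ℂ)^2+q) ∈ slitPlane := by
      left
      have : ((y:ℂ)^2+q) = ((y^2+q : ℝ):ℂ) := by push_cast; rfl
      rw [this, ofReal_re]; exact h
    have := (hasDerivAt_pow α (y:ℂ)).fun_mul (hb.cpow_const (c := -s/2) hs)
    refine this.congr_deriv ?_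
    have e : -(s+2)/2 = -s/2 - 1 := by ring
    simp only [teG, Pi.add_apply, Pi.smul_apply, smul_eq_mul, e, pow_succ]
    push_cast
    ring
  have := h1.comp_ofReal
  convert this using 1
  funext y
  simp [teG]

lemma te_G_norm (α : ℕ) (R : ℝ) (hR : 0 ≤ R) (s : ℂ) (hs : ‖s‖ ≤ R) (q y ρ : ℝ) (hq : 0 ≤ q)
    (hρ : 0 < ρ) (h1 : ρ^2 ≤ y^2+q) (h2 : y^2+q ≤ (3*ρ)^2) :
    ‖teG α s q y‖ ≤ 3^α * 3^R * ρ ^ ((α:ℝ) - s.re) := by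
  have hpos : 0 < y^2+q := lt_of_lt_of_le (by positivity) h1
  have hy : |y| ≤ 3*ρ := abs_le_of_sq_le_sq (by linarith) (by positivity)
  set r := Real.sqrt (y^2+q) with hr
  have hr1 : ρ ≤ r := Real.le_sqrt_of_sq_le h1
  have hr2 : r ≤ 3*ρ := Real.sqrt_le_iff.2 ⟨by positivity, h2⟩
  have hr0 : 0 < r := by linarith
  have hre : |s.re| ≤ R := (abs_re_le_norm s).trans hs
  have e1 : (y^2+q) ^ (-s/2).re = r ^ (-s.re) := by
    have : y^2+q = r^(2:ℝ) := by
      rw [Real.rpow_two, hr, Real.sq_sqrt hpos.le]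
    rw [this, ← Real.rpow_mul hr0.le]
    congr 1
    simp
    ring
  have e2 : r ^ (-s.re) ≤ 3^R * ρ ^ (-s.re) := by
    have hrr : r = (r/ρ) * ρ := by field_simp
    rw [hrr, Real.mul_rpow (by positivity) hρ.le]
    have h1' : 1 ≤ r/ρ := by rwa [le_div_iff₀ hρ, one_mul]
    have h3' : r/ρ ≤ 3 := by rwa [div_le_iff₀ hρ]
    gcongr
    calc (r/ρ)^(-s.re) ≤ (r/ρ)^R :=
          Real.rpow_le_rpow_of_exponent_le h1' (by linarith [neg_abs_le s.re])
      _ ≤ 3^R := Real.rpow_le_rpow (by positivity) h3' hR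
  rw [teG, norm_mul, norm_pow, Complex.norm_real, Real.norm_eq_abs,
    Complex.norm_cpow_eq_rpow_re_of_pos hpos, e1]
  calc |y|^α * r^(-s.re) ≤ (3*ρ)^α * (3^R * ρ ^ (-s.re)) := by gcongr
    _ = 3^α * 3^R * ρ ^ ((α:ℝ) - s.re) := by
      rw [sub_eq_add_neg, Real.rpow_add hρ, Real.rpow_natCast]; ring


lemma te_G_bound (N : ℕ) : ∀ (α : ℕ) (R : ℝ), 0 ≤ R → ∃ C : ℝ, 0 ≤ C ∧ ∀ s : ℂ, ‖s‖ ≤ R →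
    ∀ q y ρ : ℝ, 0 ≤ q → 0 < ρ →
    (∀ t ∈ Set.Icc (0:ℝ) N, ρ^2 ≤ (y+t)^2+q ∧ (y+t)^2+q ≤ (3*ρ)^2) →
    ‖(fwdDiff (1:ℝ))^[N] (teG α s q) y‖ ≤ C * ρ ^ ((α:ℝ) - N - s.re) := by
  induction N with
  | zero =>
    intro α R hR
    refine ⟨3^α * 3^R, by positivity, fun s hs q y ρ hq hρ h => ?_⟩
    have := h 0 (by simp)
    simp only [add_zero] at this
    simpa using te_G_norm α R hR s hs q y ρ hq hρ this.1 this.2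
  | succ N ih =>
    intro α R hR
    obtain ⟨C1, hC1, H1⟩ := ih (α-1) R hR
    obtain ⟨C2, hC2, H2⟩ := ih (α+1) (R+2) (by linarith)
    refine ⟨α * C1 + R * C2, by positivity, fun s hs q y ρ hq hρ h => ?_⟩
    rw [Function.iterate_succ_apply']
    set f := (fwdDiff (1:ℝ))^[N] (teG α s q) with hf
    set g := (α:ℂ) • teG (α-1) s q + (-s) • teG (α+1) (s+2) q with hg
    have hd : ∀ x ∈ Set.Icc y (y+1), HasDerivWithinAt f ((fwdDiff (1:ℝ))^[N] g x) (Set.Icc y (y+1)) x := by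
      intro x hx
      apply HasDerivAt.hasDerivWithinAt
      apply te_hasDerivAt_iter
      intro j hj
      apply te_hasDerivAt_G
      have hj' : (j:ℝ) ≤ N := by exact_mod_cast hj
      have := (h (x + j - y) ⟨by linarith [hx.1, (Nat.cast_nonneg j : (0:ℝ) ≤ j)],
        by push_cast; linarith [hx.2]⟩).1
      have e : y + (x + j - y) = x + j := by ring
      rw [e] at this
      exact lt_of_lt_of_le (by positivity) this
    have hb : ∀ x ∈ Set.Ico y (y+1), ‖(fwdDiff (1:ℝ))^[N] g x‖ ≤
        (α * C1 + R * C2) * ρ ^ ((α:ℝ) - (N+1:ℕ) - s.re) := by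
      intro x hx
      have hx' : ∀ t ∈ Set.Icc (0:ℝ) N, ρ^2 ≤ (x+t)^2+q ∧ (x+t)^2+q ≤ (3*ρ)^2 := by
        intro t ht
        have := h (x + t - y) ⟨by linarith [hx.1, ht.1], by push_cast; linarith [hx.2, ht.2]⟩
        have e : y + (x + t - y) = x + t := by ring
        rwa [e] at this
      have b1 := H1 s hs q x ρ hq hρ hx'
      have b2 := H2 (s+2) ((norm_add_le _ _).trans (by simpa using hs)) q x ρ hq hρ hx'
      rw [hg, fwdDiff_iter_add, fwdDiff_iter_const_smul, fwdDiff_iter_const_smul]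
      simp only [Pi.add_apply, Pi.smul_apply, smul_eq_mul]
      refine (norm_add_le _ _).trans ?_
      rw [norm_mul, norm_mul, norm_neg, add_mul]
      have e2 : (((α+1:ℕ):ℝ) - N - (s+2).re) = (α:ℝ) - (N+1:ℕ) - s.re := by
        simp; ring
      rw [e2] at b2
      refine add_le_add ?_ ?_
      · rcases Nat.eq_zero_or_pos α with h0 | h0
        · subst h0; simp
        · have e1 : (((α-1:ℕ):ℝ) - N - s.re) = (α:ℝ) - (N+1:ℕ) - s.re := by
            push_cast [Nat.cast_sub h0]; ring
          rw [e1] at b1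
          rw [Complex.norm_natCast, mul_assoc]
          gcongr
      · rw [mul_assoc]
        gcongr
    have := norm_image_sub_le_of_norm_deriv_le_segment' hd hb (y+1) ⟨by linarith, le_rfl⟩
    simpa [fwdDiff] using this

noncomputable def teR {n : ℕ} (k : Fin n → ℤ) : ℝ := Real.sqrt (∑ i, (k i : ℝ)^2)

noncomputable def teT {n : ℕ} (d : Fin n →₀ ℕ) (s : ℂ) (k : Fin n → ℤ) : ℂ :=
  if k = 0 then 0 else (∏ i, (k i : ℂ)^(d i)) * ((teR k : ℂ)^s)⁻¹

lemma te_R_pos {n : ℕ} {k : Fin n → ℤ} (hk : k ≠ 0) : 0 < teR k := by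
  obtain ⟨i, hi⟩ := Function.ne_iff.1 hk
  apply Real.sqrt_pos.2
  apply Finset.sum_pos'
  · intros; positivity
  · exact ⟨i, Finset.mem_univ _, by have : (k i : ℝ) ≠ 0 := by exact_mod_cast hi
                                    positivity⟩

lemma te_R_coord {n : ℕ} (k : Fin n → ℤ) (i : Fin n) : |(k i : ℝ)| ≤ teR k := by
  apply Real.abs_le_sqrt
  exact Finset.single_le_sum (f := fun i => (k i : ℝ)^2) (fun _ _ => sq_nonneg _) (Finset.mem_univ i)

lemma te_R_finite {n : ℕ} (M : ℝ) : {k : Fin n → ℤ | teR k < M}.Finite := by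
  apply (Set.finite_Icc (fun _ : Fin n => -⌈M⌉) (fun _ => ⌈M⌉)).subset
  intro k hk
  have h : ∀ i, |k i| ≤ ⌈M⌉ := by
    intro i
    have h1 : |(k i : ℝ)| ≤ ⌈M⌉ := (te_R_coord k i).trans (hk.le.trans (Int.le_ceil M))
    exact_mod_cast h1
  exact ⟨fun i => (abs_le.1 (h i)).1, fun i => (abs_le.1 (h i)).2⟩

lemma te_summable {n : ℕ} (r : ℝ) (hr : r < -n) :
    Summable fun k : Fin n → ℤ => teR k ^ r := by
  let b := (EuclideanSpace.basisFun (Fin n) ℝ).toBasis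
  let L := Submodule.span ℤ (Set.range b)
  have hrank : Module.finrank ℤ L = n := by
    rw [ZLattice.rank ℝ L]; simp
  have h := ZLattice.summable_norm_rpow L r (by rw [hrank]; exact hr)
  let φ : (Fin n → ℤ) → L := fun k => ⟨∑ i, k i • b i, Submodule.sum_mem _ fun i _ =>
    Submodule.smul_mem _ _ (Submodule.subset_span ⟨i, rfl⟩)⟩
  have hφ : ∀ k i, (φ k : EuclideanSpace ℝ (Fin n)) i = k i := by
    intro k i
    simp [φ, b, Pi.single_apply]
  have hinj : Function.Injective φ := by
    intro k l hkl
    funext i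
    have := hφ k i
    rw [hkl, hφ l i] at this
    exact Int.cast_injective (α := ℝ) this.symm
  refine (h.comp_injective hinj).congr fun k => ?_
  simp only [Function.comp, Submodule.coe_norm, EuclideanSpace.norm_eq, hφ, teR]
  simp

lemma te_T_diff {n : ℕ} (d : Fin n →₀ ℕ) (k : Fin n → ℤ) : Differentiable ℂ fun s => teT d s k := by
  unfold teT
  split_ifs with h
  · fun_prop
  · have h0 : (teR k : ℂ) ≠ 0 := by exact_mod_cast (te_R_pos h).ne'
    intro s
    refine (DifferentiableAt.inv ?_ ?_).const_mul _
    · exact (differentiableAt_id).const_cpow (Or.inl h0)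
    · simp [Complex.cpow_eq_zero_iff, h0]

lemma te_iter_diff {n : ℕ} (d : Fin n →₀ ℕ) (e k : Fin n → ℤ) (N : ℕ) :
    Differentiable ℂ fun s => (fwdDiff e)^[N] (teT d s) k := by
  simp only [fwdDiff_iter_eq_sum_shift, zsmul_eq_mul]
  apply Differentiable.fun_sum
  intro j _
  exact (te_T_diff d _).const_mul _

lemma te_T_eq {n : ℕ} (d : Fin n →₀ ℕ) (s : ℂ) (k : Fin n → ℤ) (i : Fin n) (N : ℕ)
    (hk : ∀ j ≤ N, k + j • Pi.single i 1 ≠ 0) :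
    (fwdDiff (Pi.single i 1))^[N] (teT d s) k =
      (∏ j ∈ Finset.univ.erase i, (k j : ℂ)^(d j)) *
      (fwdDiff (1:ℝ))^[N] (teG (d i) s (∑ j ∈ Finset.univ.erase i, (k j : ℝ)^2)) (k i) := by
  rw [fwdDiff_iter_eq_sum_shift, fwdDiff_iter_eq_sum_shift, Finset.mul_sum]
  refine Finset.sum_congr rfl fun j hj => ?_
  have hj' : j ≤ N := by simpa [Nat.lt_succ_iff] using hj
  have h0 := hk j hj'
  simp only [zsmul_eq_mul]
  rw [mul_left_comm]
  congr 1
  set l := k + j • Pi.single i 1 with hl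
  have hli : (l i : ℝ) = k i + j := by simp [hl]
  have hli' : (l i : ℂ) = k i + j := by simp [hl]
  have hlj : ∀ m ∈ Finset.univ.erase i, l m = k m := by
    intro m hm
    simp [hl, Finset.ne_of_mem_erase hm]
  have hpos := te_R_pos h0
  rw [teT, if_neg h0, teG, ← Finset.mul_prod_erase _ _ (Finset.mem_univ i)]
  have e1 : ∏ x ∈ Finset.univ.erase i, (l x : ℂ)^(d x) = ∏ x ∈ Finset.univ.erase i, (k x : ℂ)^(d x) :=
    Finset.prod_congr rfl fun m hm => by rw [hlj m hm]
  have e2 : ((k i : ℝ) + j • (1:ℝ))^2 + ∑ j ∈ Finset.univ.erase i, (k j : ℝ)^2 = teR l ^ 2 := by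
    rw [teR, Real.sq_sqrt (by positivity), ← Finset.add_sum_erase _ _ (Finset.mem_univ i), hli]
    congr 1
    · simp
    · exact Finset.sum_congr rfl fun m hm => by rw [hlj m hm]
  have e3 : ((teR l ^ 2 : ℝ) : ℂ)^(-s/2) = ((teR l : ℂ)^s)⁻¹ := by
    rw [← Complex.cpow_neg, ← Real.rpow_two,
      ← Complex.cpow_mul_ofReal_nonneg hpos.le]
    congr 1
    push_cast
    ring
  rw [e1, e2, e3, hli']
  simp only [nsmul_eq_mul, mul_one]
  push_cast
  ring

lemma te_T_bound {n : ℕ} (d : Fin n →₀ ℕ) (i : Fin n) (N : ℕ) (R : ℝ) (hR : 0 ≤ R) :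
    ∃ C : ℝ, 0 ≤ C ∧ ∀ s : ℂ, ‖s‖ ≤ R → ∀ k : Fin n → ℤ, 2 * (N:ℝ) + 1 ≤ teR k →
      ‖(fwdDiff (Pi.single i 1))^[N] (teT d s) k‖ ≤
        C * teR k ^ (((∑ j, d j : ℕ) : ℝ) - N - s.re) := by
  obtain ⟨C, hC, H⟩ := te_G_bound N (d i) R hR
  refine ⟨C * 2 ^ ((N:ℝ) + R), by positivity, fun s hs k hk => ?_⟩
  set r := teR k with hr
  set q := ∑ j ∈ Finset.univ.erase i, (k j : ℝ)^2 with hq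
  have hN0 : (0:ℝ) ≤ N := Nat.cast_nonneg N
  have hr0 : 0 < r := by linarith
  have hq0 : 0 ≤ q := by positivity
  have hyq : (k i : ℝ)^2 + q = r^2 := by
    rw [hr, teR, Real.sq_sqrt (by positivity), ← Finset.add_sum_erase _ _ (Finset.mem_univ i)]
  have hy := abs_le.1 (te_R_coord k i)
  rw [← hr] at hy
  have hrange : ∀ t ∈ Set.Icc (0:ℝ) N,
      (r/2)^2 ≤ ((k i : ℝ)+t)^2+q ∧ ((k i : ℝ)+t)^2+q ≤ (3*(r/2))^2 := by
    intro t ht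
    have ht2 : t ≤ r/2 := by linarith [ht.2]
    have e : ((k i : ℝ)+t)^2+q = r^2 + 2*(k i)*t + t^2 := by rw [← hyq]; ring
    have l1 : 0 ≤ (r + k i) * t := mul_nonneg (by linarith [hy.1]) ht.1
    have l2 : 0 ≤ (r - k i) * t := mul_nonneg (by linarith [hy.2]) ht.1
    rw [e]
    constructor
    · nlinarith [ht.1]
    · nlinarith [ht.1]
  have hne : ∀ j ≤ N, k + j • Pi.single i 1 ≠ 0 := by
    intro j hj h0
    have hj' : (j:ℝ) ≤ N := by exact_mod_cast hj
    have h1 := (hrange j ⟨Nat.cast_nonneg j, hj'⟩).1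
    have h2 : (k i : ℝ) + j = 0 := by
      have := congrFun h0 i
      simp at this
      exact_mod_cast this
    have h3 : q = 0 := by
      rw [hq]
      refine Finset.sum_eq_zero fun m hm => ?_
      have := congrFun h0 m
      simp [Finset.ne_of_mem_erase hm] at this
      simp [this]
    rw [h2, h3] at h1
    nlinarith
  rw [te_T_eq d s k i N hne, norm_mul]
  have b1 := H s hs q (k i) (r/2) hq0 (by positivity) hrange
  have b2 : ‖∏ j ∈ Finset.univ.erase i, (k j : ℂ)^(d j)‖ ≤ r ^ (∑ j ∈ Finset.univ.erase i, d j) := by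
    rw [norm_prod, ← Finset.prod_pow_eq_pow_sum]
    refine Finset.prod_le_prod (fun _ _ => norm_nonneg _) fun j _ => ?_
    rw [norm_pow, Complex.norm_intCast]
    gcongr
    exact te_R_coord k j
  have b3 : (r/2) ^ (((d i : ℕ):ℝ) - N - s.re) ≤ 2 ^ ((N:ℝ) + R) * r ^ (((d i : ℕ):ℝ) - N - s.re) := by
    rw [Real.div_rpow hr0.le (by norm_num), div_eq_mul_inv, ← Real.rpow_neg (by norm_num), mul_comm]
    gcongr
    · norm_num
    · have : s.re ≤ R := (Complex.re_le_norm s).trans hs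
      have : (0:ℝ) ≤ d i := Nat.cast_nonneg _
      linarith
  have e : r ^ (((∑ j, d j : ℕ) : ℝ) - N - s.re) =
      r ^ (∑ j ∈ Finset.univ.erase i, d j) * r ^ (((d i : ℕ):ℝ) - N - s.re) := by
    rw [← Real.rpow_natCast, ← Real.rpow_add hr0, ← Finset.add_sum_erase _ _ (Finset.mem_univ i)]
    congr 1
    push_cast
    ring
  rw [e]
  calc _ ≤ r ^ (∑ j ∈ Finset.univ.erase i, d j) *
        (C * (2 ^ ((N:ℝ) + R) * r ^ (((d i : ℕ):ℝ) - N - s.re))) := by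
        gcongr
        exact b1.trans (by gcongr)
    _ = _ := by ring

lemma te_local {n : ℕ} (d : Fin n →₀ ℕ) (i : Fin n) (N : ℕ) (s₀ : ℂ)
    (h : (n:ℝ) + (∑ j, d j : ℕ) - N < s₀.re) :
    ∃ u : (Fin n → ℤ) → ℝ, Summable u ∧ ∃ δ > 0, ∀ s ∈ Metric.ball s₀ δ, ∀ k,
      ‖(fwdDiff (Pi.single i 1))^[N] (teT d s) k‖ ≤ u k := by
  classical
  set δ := (s₀.re - ((n:ℝ) + (∑ j, d j : ℕ) - N)) / 2 with hδ
  have hδ0 : 0 < δ := by rw [hδ]; linarith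
  obtain ⟨C, hC, H⟩ := te_T_bound d i N (‖s₀‖ + δ) (by positivity)
  have hM : ∀ k : Fin n → ℤ, ∃ M : ℝ, ∀ s ∈ Metric.closedBall s₀ δ,
      ‖(fwdDiff (Pi.single i 1))^[N] (teT d s) k‖ ≤ M := fun k =>
    (isCompact_closedBall s₀ δ).exists_bound_of_continuousOn
      (te_iter_diff d (Pi.single i 1) k N).continuous.continuousOn
  choose M hM using hM
  refine ⟨fun k => if teR k < 2 * (N:ℝ) + 1 then M k else C * teR k ^ (-(n:ℝ) - δ), ?_, δ, hδ0, ?_⟩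
  · refine ((te_summable (n := n) (-(n:ℝ) - δ) (by linarith)).mul_left C).congr_cofinite ?_
    have := (te_R_finite (n := n) (2 * (N:ℝ) + 1)).compl_mem_cofinite
    filter_upwards [this] with k hk
    have hk' : ¬ teR k < 2 * (N:ℝ) + 1 := hk
    rw [if_neg hk']
  · intro s hs k
    dsimp only
    split_ifs with hk
    · exact hM k s (Metric.ball_subset_closedBall hs)
    · push Not at hk
      have hs' : ‖s - s₀‖ < δ := by rwa [← dist_eq_norm]
      have hsn : ‖s‖ ≤ ‖s₀‖ + δ := by
        have := norm_add_le s₀ (s - s₀)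
        rw [add_sub_cancel] at this
        linarith
      refine (H s hsn k hk).trans ?_
      have hre : |(s - s₀).re| < δ := (Complex.abs_re_le_norm _).trans_lt hs'
      have h1 := (abs_lt.1 hre).1
      rw [Complex.sub_re] at h1
      have hN0 : (0:ℝ) ≤ N := Nat.cast_nonneg N
      refine mul_le_mul_of_nonneg_left ?_ hC
      refine Real.rpow_le_rpow_of_exponent_le (by linarith) ?_
      linarith

noncomputable def teChi {n : ℕ} (a : Fin n → ℝ) (k : Fin n → ℤ) : ℂ :=
  Complex.exp (2 * Real.pi * Complex.I * ∑ i, (k i : ℂ) * (a i : ℂ))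

lemma te_chi_norm {n : ℕ} (a : Fin n → ℝ) (k : Fin n → ℤ) : ‖teChi a k‖ = 1 := by
  have : (2 * Real.pi * Complex.I * ∑ i, (k i : ℂ) * (a i : ℂ)) =
      ((2 * Real.pi * ∑ i, (k i : ℝ) * (a i : ℝ) : ℝ) : ℂ) * Complex.I := by
    push_cast; ring
  rw [teChi, this, Complex.norm_exp_ofReal_mul_I]

lemma te_chi_add {n : ℕ} (a : Fin n → ℝ) (k : Fin n → ℤ) (i : Fin n) :
    teChi a (k + Pi.single i 1) = Complex.exp (2 * Real.pi * Complex.I * a i) * teChi a k := by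
  rw [teChi, teChi, ← Complex.exp_add]
  congr 1
  have : ∑ j, (((k + Pi.single i 1 : Fin n → ℤ) j : ℤ) : ℂ) * (a j : ℂ) =
      a i + ∑ j, (k j : ℂ) * (a j : ℂ) := by
    simp [add_mul, Finset.sum_add_distrib, Pi.single_apply]
    ring
  rw [this]; ring

lemma te_omega_ne {x : ℝ} (hx : ∀ m : ℤ, x ≠ m) :
    (Complex.exp (2 * Real.pi * Complex.I * x))⁻¹ - 1 ≠ 0 := by
  intro h
  have h1 : Complex.exp (2 * Real.pi * Complex.I * x) = 1 := by
    have := sub_eq_zero.1 h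
    rwa [inv_eq_one] at this
  obtain ⟨m, hm⟩ := Complex.exp_eq_one_iff.1 h1
  apply hx m
  have h2 : (2 * Real.pi * Complex.I : ℂ) ≠ 0 := by simp [Real.pi_ne_zero]
  have h3 : (x : ℂ) = m := by
    apply mul_left_cancel₀ h2
    rw [hm]; ring
  exact_mod_cast h3

lemma te_shift_aux {M : Type*} [AddCommGroup M] (χ h : M → ℂ) (e : M) (w : ℂ) (hw0 : w ≠ 0)
    (hχ : ∀ k, χ (k + e) = w * χ k) (hs : Summable fun k => χ k * h k) :
    ∑' k, χ k * fwdDiff e h k = (w⁻¹ - 1) * ∑' k, χ k * h k := by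
  have h1 : HasSum (fun k => χ (k + e) * h (k + e)) (∑' k, χ k * h k) :=
    ((Equiv.addRight e).hasSum_iff (f := fun k => χ k * h k)).2 hs.hasSum
  have h2 := (h1.mul_left w⁻¹).sub hs.hasSum
  rw [sub_mul, one_mul, ← h2.tsum_eq]
  refine tsum_congr fun k => ?_
  rw [hχ, fwdDiff, mul_assoc, inv_mul_cancel_left₀ hw0, mul_sub]

lemma te_shift {n : ℕ} (a : Fin n → ℝ) (i : Fin n) (h : (Fin n → ℤ) → ℂ)
    (hs : Summable fun k => teChi a k * h k) :
    ∑' k, teChi a k * fwdDiff (Pi.single i 1) h k =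
      ((Complex.exp (2 * Real.pi * Complex.I * a i))⁻¹ - 1) * ∑' k, teChi a k * h k :=
  te_shift_aux _ _ _ _ (Complex.exp_ne_zero _) (fun k => te_chi_add a k i) hs

lemma te_monomial {n : ℕ} (d : Fin n →₀ ℕ) (a : Fin n → ℝ) (ha : ∃ i, ∀ m : ℤ, a i ≠ (m : ℝ)) :
    ∃ F : ℂ → ℂ, Differentiable ℂ F ∧ ∀ s : ℂ, (n : ℝ) + (∑ j, d j : ℕ) < s.re →
      HasSum (fun k => teChi a k * teT d s k) (F s) := by
  obtain ⟨i, hi⟩ := ha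
  set c := (Complex.exp (2 * Real.pi * Complex.I * a i))⁻¹ - 1 with hc
  have hc0 : c ≠ 0 := te_omega_ne hi
  set p : ℝ := (n : ℝ) + (∑ j, d j : ℕ) with hp
  let A (N : ℕ) (s : ℂ) : ℂ :=
    (c^N)⁻¹ * ∑' k, teChi a k * (fwdDiff (Pi.single i 1))^[N] (teT d s) k
  have hsum : ∀ (N : ℕ) (s : ℂ), p - N < s.re →
      Summable fun k => teChi a k * (fwdDiff (Pi.single i 1))^[N] (teT d s) k := by
    intro N s hs
    obtain ⟨u, hu, δ, hδ, H⟩ := te_local d i N s hs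
    refine Summable.of_norm_bounded hu fun k => ?_
    rw [norm_mul, te_chi_norm, one_mul]
    exact H s (Metric.mem_ball_self hδ) k
  have hdiff : ∀ (N : ℕ) (s : ℂ), p - N < s.re → DifferentiableAt ℂ (A N) s := by
    intro N s hs
    obtain ⟨u, hu, δ, hδ, H⟩ := te_local d i N s hs
    refine DifferentiableAt.const_mul ?_ _
    refine DifferentiableOn.differentiableAt (s := Metric.ball s δ) ?_ (Metric.ball_mem_nhds s hδ)
    refine differentiableOn_tsum_of_summable_norm hu (fun k => ?_) Metric.isOpen_ball ?_
    · exact ((te_iter_diff d _ k N).const_mul _).differentiableOn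
    · intro k w hw
      rw [norm_mul, te_chi_norm, one_mul]
      exact H w hw k
  have hstep : ∀ (N : ℕ) (s : ℂ), p - N < s.re → A (N+1) s = A N s := by
    intro N s hs
    have := te_shift a i _ (hsum N s hs)
    simp only [A, Function.iterate_succ_apply']
    rw [this, ← hc, pow_succ]
    field_simp
  have hall : ∀ (N M : ℕ) (s : ℂ), N ≤ M → p - N < s.re → A M s = A N s := by
    intro N M s hNM hs
    induction M, hNM using Nat.le_induction with
    | base => rfl
    | succ M hM ih =>
      rw [hstep M s, ih]
      have : (N:ℝ) ≤ M := by exact_mod_cast hM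
      linarith
  let ν (s : ℂ) : ℕ := ⌈p - s.re⌉₊ + 1
  have hν : ∀ s, p - ν s < s.re := by
    intro s
    have := Nat.le_ceil (p - s.re)
    simp only [ν]
    push_cast
    linarith
  refine ⟨fun s => A (ν s) s, ?_, ?_⟩
  · intro s
    refine (hdiff (ν s) s (hν s)).congr_of_eventuallyEq ?_
    have : ∀ᶠ w in nhds s, p - ν s < w.re :=
      (isOpen_lt continuous_const Complex.continuous_re).mem_nhds (hν s)
    filter_upwards [this] with w hw
    rcases le_total (ν s) (ν w) with h | h
    · exact hall _ _ w h hw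
    · exact (hall _ _ w h (hν w)).symm
  · intro s hs
    have h0 : p - (0:ℕ) < s.re := by simpa using hs
    have := (hsum 0 s h0).hasSum
    dsimp only
    rw [hall 0 (ν s) s (Nat.zero_le _) h0]
    simpa [A] using this

theorem twisted_epstein_entire {n p : ℕ}
    (P : MvPolynomial (Fin n) ℂ) (hP : P.IsHomogeneous p)
    (a : Fin n → ℝ) (ha : ∃ i, ∀ m : ℤ, a i ≠ (m : ℝ)) :
    ∃ F : ℂ → ℂ, Differentiable ℂ F ∧
      ∀ s : ℂ, (n : ℝ) + (p : ℝ) < s.re →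
        F s = ∑' k : {k : Fin n → ℤ // k ≠ 0},
          MvPolynomial.eval (fun i => ((k : Fin n → ℤ) i : ℂ)) P *
            Complex.exp (2 * Real.pi * Complex.I * ∑ i, ((k : Fin n → ℤ) i : ℂ) * (a i : ℂ)) /
            ((Real.sqrt (∑ i, (((k : Fin n → ℤ) i : ℝ)) ^ 2) : ℂ) ^ s) := by
  choose F hF1 hF2 using fun d : Fin n →₀ ℕ => te_monomial d a ha
  refine ⟨fun s => ∑ d ∈ P.support, P.coeff d * F d s, ?_, ?_⟩
  · exact Differentiable.fun_sum fun d _ => (hF1 d).const_mul _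
  · intro s hs
    have hd : ∀ d ∈ P.support, ∑ j, d j = p := by
      intro d hd
      have := hP (MvPolynomial.mem_support_iff.1 hd)
      rw [← this, Finsupp.weight_apply, Finsupp.sum_fintype _ _ (by simp)]
      simp
    have h1 : HasSum (fun k => ∑ d ∈ P.support, P.coeff d * (teChi a k * teT d s k))
        (∑ d ∈ P.support, P.coeff d * F d s) :=
      hasSum_sum fun d hd' => (hF2 d s (by rw [hd d hd']; exact hs)).mul_left _
    have h2 := (hasSum_subtype_iff_of_support_subset (s := {k : Fin n → ℤ | k ≠ 0})
      (f := fun k => ∑ d ∈ P.support, P.coeff d * (teChi a k * teT d s k)) (by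
        intro k hk h0
        apply hk
        simp [teT, h0])).2 h1
    refine h2.tsum_eq.symm.trans ?_
    refine tsum_congr fun k => ?_
    have hk : (k : Fin n → ℤ) ≠ 0 := k.2
    simp only [Function.comp, teT, if_neg hk]
    rw [MvPolynomial.eval_eq', Finset.sum_mul, Finset.sum_div]
    refine Finset.sum_congr rfl fun d _ => ?_
    rw [teChi, teR]
    ring
end

section
/- Let P be a homogeneous polynomial of degree p on ℝⁿ and a ∈ ℤⁿ. The function f_a(s) = ∑_{k ∈ ℤⁿ, k≠0} P(k)/‖k‖^s has a meromorphic continuation to ℂ whose only possible pole is at s = n + p, which is simple with residue ∫_{S^{n−1}} P(u) dS(u); in particular f_a is entire if and only if ∫_{S^{n−1}} P(u) dS(u) = 0. -/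
open Complex MeasureTheory
open scoped FourierTransform SchwartzMap


theorem ep_gauss_pow_bound (j : ℕ) (x : ℝ) : |x| ^ j * Real.exp (-x ^ 2) ≤ j.factorial * Real.exp 1 := by
  have h1 : |x| ^ j / j.factorial ≤ Real.exp |x| := Real.pow_div_factorial_le_exp _ (abs_nonneg x) j
  have h2 : |x| ^ j ≤ j.factorial * Real.exp |x| := by
    rw [div_le_iff₀ (by positivity)] at h1; linarith
  calc |x| ^ j * Real.exp (-x ^ 2) ≤ j.factorial * Real.exp |x| * Real.exp (-x ^ 2) := by gcongr
    _ = j.factorial * Real.exp (|x| - x ^ 2) := by rw [mul_assoc, ← Real.exp_add]; ring_nf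
    _ ≤ _ := by
      gcongr
      rw [← sq_abs]; nlinarith [sq_nonneg (|x| - 1), abs_nonneg x]

theorem ep_gauss_poly_bound (q : Polynomial ℝ) (j : ℕ) :
    ∃ C, ∀ x : ℝ, |x| ^ j * |q.eval x * Real.exp (-x ^ 2)| ≤ C := by
  induction q using Polynomial.induction_on' with
  | add p q hp hq =>
    obtain ⟨C, hC⟩ := hp
    obtain ⟨D, hD⟩ := hq
    refine ⟨C + D, fun x => ?_⟩
    rw [Polynomial.eval_add, add_mul]
    calc _ ≤ |x| ^ j * (|p.eval x * Real.exp (-x ^ 2)| + |q.eval x * Real.exp (-x ^ 2)|) := by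
          gcongr; exact abs_add_le _ _
      _ ≤ _ := by rw [mul_add]; exact add_le_add (hC x) (hD x)
  | monomial m a =>
    refine ⟨|a| * ((j + m).factorial * Real.exp 1), fun x => ?_⟩
    have := ep_gauss_pow_bound (j + m) x
    rw [Polynomial.eval_monomial, abs_mul, abs_mul, abs_pow, abs_of_pos (Real.exp_pos _)]
    calc _ = |a| * (|x| ^ (j + m) * Real.exp (-x ^ 2)) := by ring
      _ ≤ _ := by gcongr

theorem ep_iteratedDeriv (k : ℕ) : ∀ q : Polynomial ℝ, ∃ r : Polynomial ℝ,
    iteratedDeriv k (fun x : ℝ => ((q.eval x * Real.exp (-x ^ 2) : ℝ) : ℂ)) =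
      fun x : ℝ => ((r.eval x * Real.exp (-x ^ 2) : ℝ) : ℂ) := by
  induction k with
  | zero => intro q; exact ⟨q, by simp⟩
  | succ k ih =>
    intro q
    obtain ⟨r, hr⟩ := ih (q.derivative + q * (-2 * Polynomial.X))
    refine ⟨r, ?_⟩
    rw [iteratedDeriv_succ', ← hr]
    congr 1
    ext x
    apply HasDerivAt.deriv
    apply HasDerivAt.ofReal_comp
    have h1 := (q.hasDerivAt x).mul (((hasDerivAt_pow 2 x).neg).exp)
    convert! h1 using 1
    simp
    ring

theorem ep_schwartz (m : ℕ) : ∃ g : 𝓢(ℝ, ℂ), ∀ x : ℝ, g x = ((x ^ m * Real.exp (-x ^ 2) : ℝ) : ℂ) := by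
  refine ⟨⟨fun x : ℝ => (((Polynomial.X ^ m : Polynomial ℝ).eval x * Real.exp (-x ^ 2) : ℝ) : ℂ), ?_, ?_⟩, ?_⟩
  · have : ContDiff ℝ (⊤ : ℕ∞) (fun x : ℝ => ((Polynomial.X ^ m : Polynomial ℝ).eval x * Real.exp (-x ^ 2) : ℝ)) := by
      simp only [Polynomial.eval_pow, Polynomial.eval_X]
      fun_prop
    exact Complex.ofRealCLM.contDiff.comp this
  · intro k j
    obtain ⟨r, hr⟩ := ep_iteratedDeriv j (Polynomial.X ^ m)
    obtain ⟨C, hC⟩ := ep_gauss_poly_bound r k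
    refine ⟨C, fun x => ?_⟩
    rw [norm_iteratedFDeriv_eq_norm_iteratedDeriv, hr, Complex.norm_real, Real.norm_eq_abs, Real.norm_eq_abs]
    exact hC x
  · intro x
    change (((Polynomial.X ^ m : Polynomial ℝ).eval x * Real.exp (-x ^ 2) : ℝ) : ℂ) = _
    simp

theorem ep_riemann (g : 𝓢(ℝ, ℂ)) (N : ℕ) : ∃ C, ∀ h : ℝ, 0 < h →
    ‖(h : ℂ) * ∑' k : ℤ, g (h * k) - ∫ x, g x‖ ≤ C * h ^ (N + 2) := by
  obtain ⟨C, hC0, hC⟩ := (𝓕 g).decay (N + 2) 0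
  simp only [norm_iteratedFDeriv_zero] at hC
  have hS : Summable fun k : ℤ => 1 / |(k : ℝ)| ^ (N + 2) := by
    have := Real.summable_abs_int_rpow (b := (N + 2 : ℕ)) (by push_cast; linarith)
    refine this.congr fun k => ?_
    rw [Real.rpow_neg (abs_nonneg _), Real.rpow_natCast, one_div]
  refine ⟨C * ∑' k : ℤ, 1 / |(k : ℝ)| ^ (N + 2), fun h hh => ?_⟩
  let e : ℝ ≃L[ℝ] ℝ := ContinuousLinearEquiv.unitsEquivAut ℝ (Units.mk0 h hh.ne')
  let f : 𝓢(ℝ, ℂ) := SchwartzMap.compCLMOfContinuousLinearEquiv ℂ e g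
  have hf : ∀ x, f x = g (h * x) := fun x => by
    simp [f, e, mul_comm]
  have hF : ∀ ξ : ℝ, (𝓕 f) ξ = (h : ℂ)⁻¹ * (𝓕 g) (ξ / h) := fun ξ => by
    rw [SchwartzMap.fourier_coe, SchwartzMap.fourier_coe, Real.fourier_eq', Real.fourier_eq']
    have := Measure.integral_comp_mul_left
      (fun v : ℝ => cexp (↑(-2 * Real.pi * inner ℝ v (ξ / h)) * I) • g v) h
    rw [abs_of_pos (inv_pos.mpr hh)] at this
    rw [real_smul, ofReal_inv] at this
    rw [← this]
    congr 1
    ext v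
    rw [hf]
    congr 5
    simp
    field_simp
  have hP := f.tsum_eq_tsum_fourier 0
  simp only [zero_add, hf, hF] at hP
  have h0 : (𝓕 g) 0 = ∫ x, g x := by
    rw [SchwartzMap.fourier_coe, Real.fourier_eq']
    simp
  have hb : ∀ k : ℤ, k ≠ 0 → ‖(𝓕 g) (k / h)‖ ≤ C * h ^ (N + 2) * (1 / |(k : ℝ)| ^ (N + 2)) := by
    intro k hk
    have := hC (k / h)
    have hk' : 0 < |(k : ℝ)| := by positivity
    rw [norm_div, Real.norm_eq_abs, Real.norm_eq_abs, abs_of_pos hh, div_pow] at this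
    field_simp at this ⊢
    linarith
  have hb' : ∀ k : ℤ, ‖(if k = 0 then 0 else (𝓕 g) (k / h))‖ ≤ C * h ^ (N + 2) * (1 / |(k : ℝ)| ^ (N + 2)) := by
    intro k
    split_ifs with hk
    · simp; positivity
    · exact hb k hk
  have hs1 : Summable (fun k : ℤ => if k = 0 then 0 else (𝓕 g) (k / h)) :=
    Summable.of_norm_bounded (hS.mul_left _) hb'
  have hs2 : HasSum (fun k : ℤ => (𝓕 g) (k / h)) ((∫ x, g x) + ∑' k : ℤ, (if k = 0 then 0 else (𝓕 g) (k / h))) := by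
    have h3 := (hasSum_ite_eq (0 : ℤ) (∫ x, g x)).add hs1.hasSum
    convert! h3 using 2 with k
    split_ifs with hk
    · simp [hk, h0]
    · simp
  have : (h : ℂ) * ∑' k : ℤ, g (h * k) - ∫ x, g x = ∑' k : ℤ, (if k = 0 then 0 else (𝓕 g) (k / h)) := by
    rw [hP]
    simp only [QuotientAddGroup.mk_zero, fourier_eval_zero, mul_one, tsum_mul_left]
    rw [hs2.tsum_eq]
    have : (h : ℂ) ≠ 0 := by exact_mod_cast hh.ne'
    field_simp
    ring
  rw [this]
  refine (tsum_of_norm_bounded (hS.mul_left _).hasSum hb').trans (le_of_eq ?_)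
  rw [tsum_mul_left]; ring

theorem ep_tsum_pi (n : ℕ) (f : Fin n → ℤ → ℂ) (hf : ∀ i, Summable fun k => ‖f i k‖) :
    (Summable fun k : Fin n → ℤ => ‖∏ i, f i (k i)‖) ∧
      ∑' k : Fin n → ℤ, ∏ i, f i (k i) = ∏ i, ∑' k, f i k := by
  induction n with
  | zero => exact ⟨Summable.of_finite, by simp⟩
  | succ n ih =>
    obtain ⟨h1, h2⟩ := ih (fun i => f i.succ) (fun i => hf _)
    have e := (Fin.consEquiv (fun _ : Fin (n + 1) => ℤ))
    have h3 := (hf 0).mul_norm h1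
    have h4 := tsum_mul_tsum_of_summable_norm (hf 0) h1
    constructor
    · rw [← (Fin.consEquiv (fun _ : Fin (n + 1) => ℤ)).summable_iff]
      refine h3.congr fun k => ?_
      simp [Fin.prod_univ_succ, Fin.consEquiv]
    · rw [← (Fin.consEquiv (fun _ : Fin (n + 1) => ℤ)).tsum_eq, Fin.prod_univ_succ, ← h2, h4]
      refine tsum_congr fun k => ?_
      simp [Fin.prod_univ_succ, Fin.consEquiv]

theorem ep_lattice (n : ℕ) (r : ℝ) (hr : (n : ℝ) < r) :
    Summable fun k : Fin n → ℤ => ‖fun i => (k i : ℝ)‖ ^ (-r) := by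
  let L := Submodule.span ℤ (Set.range (Pi.basisFun ℝ (Fin n)))
  have h := ZLattice.summable_norm_rpow L (-r) (by
    rw [ZLattice.rank ℝ L]; simpa using hr)
  have hm : ∀ k : Fin n → ℤ, (fun i => (k i : ℝ)) ∈ L := fun k => by
    rw [Module.Basis.mem_span_iff_repr_mem]
    simp
  let φ : (Fin n → ℤ) → L := fun k => ⟨fun i => (k i : ℝ), hm k⟩
  have hφ : Function.Injective φ := fun a b hab => by
    ext i
    have h1 : (a i : ℝ) = b i := congrFun (congrArg Subtype.val hab) i
    exact_mod_cast h1
  have h2 : Summable (fun k => ‖φ k‖ ^ (-r)) := h.comp_injective hφ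
  refine h2.congr fun k => ?_
  rw [Submodule.coe_norm]

open Asymptotics Topology Filter in
theorem ep_prod_isBigO {ι : Type*} (S : Finset ι) (A : ι → ℝ → ℂ) (b : ι → ℂ) (N : ℕ)
    (h : ∀ i, (fun t => A i t - b i) =O[𝓝[>] (0 : ℝ)] fun t => t ^ N) :
    (fun t => ∏ i ∈ S, A i t - ∏ i ∈ S, b i) =O[𝓝[>] (0 : ℝ)] fun t => t ^ N := by
  classical
  have hN : (fun t : ℝ => t ^ N) =O[𝓝[>] (0 : ℝ)] fun _ => (1 : ℝ) := by
    have : ContinuousAt (fun t : ℝ => t ^ N) 0 := by fun_prop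
    exact (this.tendsto.isBigO_one ℝ).mono nhdsWithin_le_nhds
  have hA : ∀ i, A i =O[𝓝[>] (0 : ℝ)] fun _ => (1 : ℝ) := fun i => by
    have := ((h i).trans hN).add (isBigO_const_const (b i) (one_ne_zero (α := ℝ)) (𝓝[>] (0 : ℝ)))
    simpa using this
  have hA' : ∀ S : Finset ι, (fun t => ∏ i ∈ S, A i t) =O[𝓝[>] (0 : ℝ)] fun _ => (1 : ℝ) := fun S => by
    induction S using Finset.induction_on with
    | empty => simpa using isBigO_const_const (1 : ℂ) (one_ne_zero (α := ℝ)) (𝓝[>] (0 : ℝ))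
    | insert i S hi ih =>
      simp only [Finset.prod_insert hi]
      simpa using (hA i).mul ih
  induction S using Finset.induction_on with
  | empty => simpa using isBigO_zero _ _
  | insert i S hi ih =>
    simp only [Finset.prod_insert hi]
    have h1 := (h i).mul (hA' S)
    have h2 := ih.const_mul_left (b i)
    simp only [mul_one] at h1
    refine (h1.add h2).congr_left fun t => ?_
    ring

theorem ep_degree {n p : ℕ} {P : MvPolynomial (Fin n) ℂ} (hP : P.IsHomogeneous p)
    {α : Fin n →₀ ℕ} (h : α ∈ P.support) : ∑ i, α i = p := by
  have := hP (MvPolynomial.mem_support_iff.mp h)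
  rw [Pi.one_def, ← Finsupp.degree_eq_weight_one] at this
  rw [← this, Finsupp.degree_eq_sum]

open Asymptotics Topology Filter in
theorem ep_mono (n : ℕ) (α : Fin n → ℕ) (N : ℕ) :
    Integrable (fun x : Fin n → ℝ => (∏ i, (x i : ℂ) ^ α i) * (Real.exp (-∑ i, x i ^ 2) : ℂ)) ∧
    (fun h : ℝ => (h : ℂ) ^ (n + ∑ i, α i) *
      ∑' k : Fin n → ℤ, (∏ i, (k i : ℂ) ^ α i) * (Real.exp (-(∑ i, (k i : ℝ) ^ 2) * h ^ 2) : ℂ) -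
      ∫ x : Fin n → ℝ, (∏ i, (x i : ℂ) ^ α i) * (Real.exp (-∑ i, x i ^ 2) : ℂ))
      =O[𝓝[>] (0 : ℝ)] fun h => h ^ N := by
  choose g hg using ep_schwartz
  have hx : ∀ x : Fin n → ℝ, (∏ i, (x i : ℂ) ^ α i) * (Real.exp (-∑ i, x i ^ 2) : ℂ) =
      ∏ i, g (α i) (x i) := fun x => by
    simp only [hg]
    push_cast
    rw [Finset.prod_mul_distrib, ← Complex.exp_sum, Finset.sum_neg_distrib]
  simp only [hx]
  refine ⟨Integrable.fintype_prod (f := fun i => g (α i)) (fun i => (g (α i)).integrable), ?_⟩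
  rw [integral_fintype_prod_volume_eq_prod (fun i x => g (α i) x)]
  have hr : ∀ i : Fin n, (fun h : ℝ => (h : ℂ) * ∑' k : ℤ, g (α i) (h * k) - ∫ x, g (α i) x)
      =O[𝓝[>] (0 : ℝ)] fun t => t ^ N := fun i => by
    obtain ⟨C, hC⟩ := ep_riemann (g (α i)) N
    have h1 : (fun h : ℝ => (h : ℂ) * ∑' k : ℤ, g (α i) (h * k) - ∫ x, g (α i) x)
      =O[𝓝[>] (0 : ℝ)] fun t => t ^ (N + 2) := by
      refine IsBigO.of_bound C ?_
      filter_upwards [self_mem_nhdsWithin] with h hh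
      rw [norm_pow, Real.norm_eq_abs, abs_of_pos hh]
      exact hC h hh
    refine h1.trans (IsBigO.of_bound 1 ?_)
    filter_upwards [Ioo_mem_nhdsGT (zero_lt_one (α := ℝ))] with h hh
    rw [norm_pow, norm_pow, Real.norm_eq_abs, abs_of_pos hh.1, one_mul]
    exact pow_le_pow_of_le_one hh.1.le hh.2.le (by omega)
  refine (ep_prod_isBigO Finset.univ _ _ N hr).congr' ?_ EventuallyEq.rfl
  filter_upwards [self_mem_nhdsWithin] with h hh
  congr 1
  have hh : 0 < h := hh
  have hs : ∀ i, Summable fun k : ℤ => ‖g (α i) (h * k)‖ := fun i => by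
    obtain ⟨C, hC0, hC⟩ := (g (α i)).decay 2 0
    simp only [norm_iteratedFDeriv_zero] at hC
    have hS := Real.summable_abs_int_rpow (b := (2 : ℕ)) (by norm_num)
    rw [← summable_norm_iff]
    refine summable_of_isBigO hS (IsBigO.of_bound (C / h ^ 2) ?_)
    have : ∀ᶠ k : ℤ in cofinite, k ≠ 0 := by
      simpa using (Set.finite_singleton (0 : ℤ)).compl_mem_cofinite
    filter_upwards [this] with k hk
    have h2 := hC (h * k)
    have hk' : 0 < |(k : ℝ)| := by positivity
    rw [Real.rpow_neg (abs_nonneg _), Real.rpow_natCast, norm_norm, norm_norm, norm_inv, norm_pow,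
      Real.norm_eq_abs, abs_abs]
    rw [norm_mul, Real.norm_eq_abs, Real.norm_eq_abs, abs_of_pos hh] at h2
    field_simp
    linarith
  rw [Finset.prod_mul_distrib, ← (ep_tsum_pi n _ hs).2, Finset.prod_const, Finset.card_univ,
    Fintype.card_fin, pow_add, mul_assoc]
  congr 1
  rw [← tsum_mul_left]
  refine tsum_congr fun k => ?_
  have := hx (fun i => h * k i)
  rw [← this]
  push_cast
  rw [← Finset.prod_pow_eq_pow_sum, ← mul_assoc, ← Finset.prod_mul_distrib]
  simp only [mul_pow, Finset.mul_sum, Finset.sum_mul, ← Finset.sum_neg_distrib]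
  congr 2
  refine Finset.sum_congr rfl fun i _ => ?_
  ring

theorem ep_bound {n p : ℕ} {P : MvPolynomial (Fin n) ℂ} (hP : P.IsHomogeneous p) :
    ∃ B : ℝ, 0 ≤ B ∧ ∀ x : Fin n → ℝ, ‖MvPolynomial.eval (fun i => (x i : ℂ)) P‖ ≤ B * ‖x‖ ^ p := by
  refine ⟨∑ α ∈ P.support, ‖P.coeff α‖, Finset.sum_nonneg fun _ _ => norm_nonneg _, fun x => ?_⟩
  rw [MvPolynomial.eval_eq', Finset.sum_mul]
  refine (norm_sum_le _ _).trans (Finset.sum_le_sum fun α hα => ?_)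
  rw [norm_mul, norm_prod]
  gcongr
  rw [← ep_degree hP hα, ← Finset.prod_pow_eq_pow_sum]
  refine Finset.prod_le_prod (fun _ _ => norm_nonneg _) fun i _ => ?_
  rw [norm_pow, Complex.norm_real]
  gcongr
  exact norm_le_pi_norm x i

theorem ep_norm_sq_le {n : ℕ} (x : Fin n → ℝ) : ‖x‖ ^ 2 ≤ ∑ i, x i ^ 2 := by
  have h : ‖x‖ ≤ Real.sqrt (∑ i, x i ^ 2) := by
    refine (pi_norm_le_iff_of_nonneg (Real.sqrt_nonneg _)).mpr fun i => ?_
    rw [Real.norm_eq_abs]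
    apply Real.abs_le_sqrt
    exact Finset.single_le_sum (f := fun i => x i ^ 2) (fun j _ => sq_nonneg _) (Finset.mem_univ i)
  have h2 := pow_le_pow_left₀ (norm_nonneg x) h 2
  rwa [Real.sq_sqrt (Finset.sum_nonneg fun i _ => sq_nonneg _)] at h2

theorem ep_norm_pos {n : ℕ} {k : Fin n → ℤ} (hk : k ≠ 0) : 0 < ‖fun i => (k i : ℝ)‖ := by
  rw [norm_pos_iff]
  intro h
  apply hk
  ext i
  have h1 : (k i : ℝ) = 0 := congrFun h i
  exact_mod_cast h1

theorem ep_R_ge_one {n : ℕ} {k : Fin n → ℤ} (hk : k ≠ 0) : 1 ≤ ∑ i, (k i : ℝ) ^ 2 := by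
  have h0 := ep_norm_pos hk
  have h1 := ep_norm_sq_le (fun i => (k i : ℝ))
  have h2 : 0 < ∑ i, (k i : ℝ) ^ 2 := lt_of_lt_of_le (by positivity) h1
  have h3 : (0 : ℤ) < ∑ i, (k i) ^ 2 := by exact_mod_cast h2
  have h4 : (1 : ℤ) ≤ ∑ i, (k i) ^ 2 := h3
  exact_mod_cast h4

theorem ep_summ {n p : ℕ} {P : MvPolynomial (Fin n) ℂ} (hP : P.IsHomogeneous p) (σ : ℝ)
    (hσ : (n : ℝ) + p < 2 * σ) :
    Summable fun k : {k : Fin n → ℤ // k ≠ 0} =>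
      ‖MvPolynomial.eval (fun i => ((k : Fin n → ℤ) i : ℂ)) P‖ /
        (∑ i, (((k : Fin n → ℤ) i : ℝ)) ^ 2) ^ σ := by
  obtain ⟨B, hB0, hB⟩ := ep_bound hP
  have h := (ep_lattice n (2 * σ - p) (by linarith)).mul_left B
  have h' := h.comp_injective (Subtype.val_injective (p := fun k : Fin n → ℤ => k ≠ 0))
  refine Summable.of_nonneg_of_le (fun k => ?_) (fun k => ?_) h'
  · have := ep_R_ge_one k.2
    positivity
  · have h0 := ep_norm_pos k.2
    have h1 := ep_norm_sq_le (fun i => ((k : Fin n → ℤ) i : ℝ))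
    have h2 := hB (fun i => ((k : Fin n → ℤ) i : ℝ))
    simp only [ofReal_intCast] at h2
    have hσ0 : 0 ≤ σ := by
      have : (0 : ℝ) ≤ n + p := by positivity
      linarith
    simp only [Function.comp]
    set y := ‖fun i => ((k : Fin n → ℤ) i : ℝ)‖
    calc _ ≤ B * y ^ p / (y ^ 2) ^ σ := by gcongr
      _ = _ := by
        rw [neg_sub, Real.rpow_sub h0, Real.rpow_natCast, mul_div_assoc, Real.rpow_mul h0.le]
        norm_num

theorem ep_summ_exp {n p : ℕ} {P : MvPolynomial (Fin n) ℂ} (hP : P.IsHomogeneous p) (a : ℝ)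
    (ha : 0 < a) :
    Summable fun k : Fin n → ℤ =>
      ‖MvPolynomial.eval (fun i => (k i : ℂ)) P‖ * Real.exp (-(∑ i, (k i : ℝ) ^ 2) * a) := by
  rw [← Finset.summable_compl_iff {0}]
  have h := (ep_summ hP (n + p + 1 : ℕ) (by
    have h1 : (0 : ℝ) ≤ n := by positivity
    have h2 : (0 : ℝ) ≤ p := by positivity
    push_cast; linarith)).mul_left ((n + p + 1).factorial / a ^ (n + p + 1))
  let e : {k : Fin n → ℤ // k ∉ ({0} : Finset (Fin n → ℤ))} → {k : Fin n → ℤ // k ≠ 0} :=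
    fun k => ⟨k.1, by simpa using k.2⟩
  have he : Function.Injective e := fun a b hab => Subtype.ext (congrArg (fun z => z.1) hab)
  refine Summable.of_nonneg_of_le (fun k => by positivity) (fun k => ?_) (h.comp_injective he)
  simp only [Function.comp, e]
  have hR := ep_R_ge_one (e k).2
  simp only [e] at hR
  set R := ∑ i, (k.1 i : ℝ) ^ 2
  set M := n + p + 1
  have h1 := Real.pow_div_factorial_le_exp (R * a) (by positivity) M
  rw [Real.rpow_natCast, neg_mul, Real.exp_neg]
  have h2 : (Real.exp (R * a))⁻¹ ≤ ((R * a) ^ M / M.factorial)⁻¹ := by gcongr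
  calc _ ≤ ‖MvPolynomial.eval (fun i => (k.1 i : ℂ)) P‖ * ((R * a) ^ M / M.factorial)⁻¹ := by gcongr
    _ = _ := by
      rw [inv_div, mul_pow]; field_simp

open Asymptotics Topology Filter in
theorem ep_asymp {n p : ℕ} {P : MvPolynomial (Fin n) ℂ} (hP : P.IsHomogeneous p) (N : ℕ) :
    (fun h : ℝ => (h : ℂ) ^ (n + p) *
      ∑' k : Fin n → ℤ, MvPolynomial.eval (fun i => (k i : ℂ)) P *
        (Real.exp (-(∑ i, (k i : ℝ) ^ 2) * h ^ 2) : ℂ) -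
      ∫ x : Fin n → ℝ, MvPolynomial.eval (fun i => (x i : ℂ)) P * (Real.exp (-∑ i, x i ^ 2) : ℂ))
      =O[𝓝[>] (0 : ℝ)] fun h => h ^ N := by
  have h1 : (fun h : ℝ => ∑ α ∈ P.support, P.coeff α * ((h : ℂ) ^ (n + ∑ i, α i) *
      ∑' k : Fin n → ℤ, (∏ i, (k i : ℂ) ^ α i) * (Real.exp (-(∑ i, (k i : ℝ) ^ 2) * h ^ 2) : ℂ) -
      ∫ x : Fin n → ℝ, (∏ i, (x i : ℂ) ^ α i) * (Real.exp (-∑ i, x i ^ 2) : ℂ)))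
      =O[𝓝[>] (0 : ℝ)] fun h => h ^ N :=
    IsBigO.fun_sum fun α _ => ((ep_mono n α N).2).const_mul_left _
  refine h1.congr' ?_ EventuallyEq.rfl
  filter_upwards [self_mem_nhdsWithin] with h hh
  have hh : 0 < h := hh
  have hs : ∀ α : Fin n →₀ ℕ, Summable fun k : Fin n → ℤ =>
      (∏ i, (k i : ℂ) ^ α i) * (Real.exp (-(∑ i, (k i : ℝ) ^ 2) * h ^ 2) : ℂ) := fun α => by
    have := ep_summ_exp (MvPolynomial.isHomogeneous_monomial (R := ℂ) (d := α) (n := α.degree) 1 rfl)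
      (h ^ 2) (by positivity)
    refine Summable.of_norm (this.congr fun k => ?_)
    rw [norm_mul, Complex.norm_real, Real.norm_eq_abs, abs_of_pos (Real.exp_pos _),
      MvPolynomial.eval_monomial, one_mul, Finsupp.prod_fintype _ _ (by simp)]
  have e1 : ∑' k : Fin n → ℤ, MvPolynomial.eval (fun i => (k i : ℂ)) P *
        (Real.exp (-(∑ i, (k i : ℝ) ^ 2) * h ^ 2) : ℂ) = ∑ α ∈ P.support, P.coeff α *
      ∑' k : Fin n → ℤ, (∏ i, (k i : ℂ) ^ α i) * (Real.exp (-(∑ i, (k i : ℝ) ^ 2) * h ^ 2) : ℂ) := by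
    simp only [MvPolynomial.eval_eq', Finset.sum_mul, ← tsum_mul_left]
    rw [← Summable.tsum_finsetSum (fun α _ => (hs α).mul_left _)]
    simp only [mul_assoc]
  have e2 : ∫ x : Fin n → ℝ, MvPolynomial.eval (fun i => (x i : ℂ)) P * (Real.exp (-∑ i, x i ^ 2) : ℂ)
      = ∑ α ∈ P.support, P.coeff α *
      ∫ x : Fin n → ℝ, (∏ i, (x i : ℂ) ^ α i) * (Real.exp (-∑ i, x i ^ 2) : ℂ) := by
    simp only [MvPolynomial.eval_eq', Finset.sum_mul, ← integral_const_mul]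
    simp only [mul_assoc]
    exact integral_finsetSum _ (fun α _ => ((ep_mono n α 0).1).const_mul _)
  rw [e1, e2, Finset.mul_sum, ← Finset.sum_sub_distrib]
  refine Finset.sum_congr rfl fun α hα => ?_
  rw [ep_degree hP hα]
  ring

theorem ep_eval_smul {n p : ℕ} {P : MvPolynomial (Fin n) ℂ} (hP : P.IsHomogeneous p) (r : ℂ)
    (x : Fin n → ℂ) : MvPolynomial.eval (fun i => r * x i) P = r ^ p * MvPolynomial.eval x P := by
  rw [MvPolynomial.eval_eq', MvPolynomial.eval_eq', Finset.mul_sum]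
  refine Finset.sum_congr rfl fun α hα => ?_
  rw [← ep_degree hP hα, ← Finset.prod_pow_eq_pow_sum]
  simp only [mul_pow, Finset.prod_mul_distrib]
  ring

theorem ep_polar {n p : ℕ} (hn : 0 < n) {P : MvPolynomial (Fin n) ℂ} (hP : P.IsHomogeneous p) :
    ∫ x : Fin n → ℝ, MvPolynomial.eval (fun i => (x i : ℂ)) P * (Real.exp (-∑ i, x i ^ 2) : ℂ) =
      (∫ u : Metric.sphere (0 : EuclideanSpace ℝ (Fin n)) 1,
              MvPolynomial.eval (fun i => ((u : EuclideanSpace ℝ (Fin n)) i : ℂ)) P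
                ∂((volume : Measure (EuclideanSpace ℝ (Fin n))).toSphere)) *
        (1 / 2 * Gamma (((n : ℂ) + p) / 2)) := by
  have : Nonempty (Fin n) := ⟨⟨0, hn⟩⟩
  let E := EuclideanSpace ℝ (Fin n)
  have e1 := (PiLp.volume_preserving_toLp (Fin n)).integral_comp
    (MeasurableEquiv.toLp 2 _).measurableEmbedding
    (fun x : E => MvPolynomial.eval (fun i => (x i : ℂ)) P * (Real.exp (-‖x‖ ^ 2) : ℂ))
  have e0 : ∀ x : Fin n → ℝ, ∑ i, x i ^ 2 = ‖(WithLp.toLp 2 x : E)‖ ^ 2 := fun x => by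
    rw [EuclideanSpace.real_norm_sq_eq]
  simp only [e0]
  refine e1.trans ?_
  have e2 : ∫ x : E, MvPolynomial.eval (fun i => (x i : ℂ)) P * (Real.exp (-‖x‖ ^ 2) : ℂ) =
      ∫ x : ({(0)}ᶜ : Set E), MvPolynomial.eval (fun i => (x.1 i : ℂ)) P * (Real.exp (-‖x.1‖ ^ 2) : ℂ)
        ∂((volume : Measure E).comap (↑)) := by
    rw [integral_subtype_comap (measurableSet_singleton _).compl
      (fun x : E => MvPolynomial.eval (fun i => (x i : ℂ)) P * (Real.exp (-‖x‖ ^ 2) : ℂ)),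
        restrict_compl_singleton]
  have e3 := (volume : Measure E).measurePreserving_homeomorphUnitSphereProd.integral_comp
        (Homeomorph.measurableEmbedding _)
    (fun z : Metric.sphere (0 : E) 1 × Set.Ioi (0 : ℝ) =>
      MvPolynomial.eval (fun i => (z.1.1 i : ℂ)) P * ((z.2.1 ^ p * Real.exp (-z.2.1 ^ 2) : ℝ) : ℂ))
  have e4 := integral_prod_mul (μ := (volume : Measure E).toSphere)
    (ν := Measure.volumeIoiPow (Module.finrank ℝ E - 1))
    (fun u : Metric.sphere (0 : E) 1 => MvPolynomial.eval (fun i => (u.1 i : ℂ)) P)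
    (fun r : Set.Ioi (0 : ℝ) => ((r.1 ^ p * Real.exp (-r.1 ^ 2) : ℝ) : ℂ))
  have e5 : ∫ r : Set.Ioi (0 : ℝ), ((r.1 ^ p * Real.exp (-r.1 ^ 2) : ℝ) : ℂ)
      ∂(Measure.volumeIoiPow (Module.finrank ℝ E - 1)) = 1 / 2 * Gamma (((n : ℂ) + p) / 2) := by
    have hd : Module.finrank ℝ E = n := by simp [E]
    rw [hd, integral_complex_ofReal]
    have : ∫ r : Set.Ioi (0 : ℝ), (r.1 ^ p * Real.exp (-r.1 ^ 2))
      ∂(Measure.volumeIoiPow (n - 1)) = 1 / 2 * Real.Gamma (((n : ℝ) + p) / 2) := by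
      simp only [Measure.volumeIoiPow, ENNReal.ofReal]
      rw [integral_withDensity_eq_integral_smul
        ((measurable_subtype_coe.pow_const _).real_toNNReal),
        integral_subtype_comap measurableSet_Ioi
          fun a : ℝ ↦ Real.toNNReal (a ^ (n - 1)) • (a ^ p * Real.exp (-a ^ 2))]
      have h6 := _root_.integral_rpow_mul_exp_neg_rpow (p := 2) (q := (n : ℝ) - 1 + p) (by norm_num) (by
        have : (0 : ℝ) < n := by exact_mod_cast hn
        have : (0 : ℝ) ≤ p := by positivity
        linarith)
      rw [show ((n : ℝ) - 1 + p + 1) = n + p by ring] at h6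
      rw [← h6]
      refine setIntegral_congr_fun measurableSet_Ioi fun x hx => ?_
      have hx : 0 < x := hx
      have h7 : x ^ ((n : ℝ) - 1) = x ^ (n - 1) := by
        rw [← Real.rpow_natCast, Nat.cast_sub hn, Nat.cast_one]
      have h8 : x ^ (2 : ℝ) = x ^ 2 := Real.rpow_two x
      rw [NNReal.smul_def, Real.coe_toNNReal _ (by positivity), Real.rpow_add hx, Real.rpow_natCast,
        h7, h8, smul_eq_mul, mul_assoc]
    rw [this]
    push_cast
    rw [← Complex.Gamma_ofReal]
    push_cast
    rfl
  rw [e2, ← e5, ← e4, ← e3]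
  congr 1
  ext x
  have hx0 : (x : E) ≠ 0 := x.2
  have hx : 0 < ‖(x : E)‖ := norm_pos_iff.mpr hx0
  simp only [homeomorphUnitSphereProd_apply_snd_coe, homeomorphUnitSphereProd_apply_fst_coe]
  push_cast
  rw [← mul_assoc]
  congr 1
  have := ep_eval_smul hP (((‖(x : E)‖ : ℝ) : ℂ)) (fun i => (((‖(x : E)‖⁻¹ • (x : E)) i : ℝ) : ℂ))
  rw [mul_comm, ← this]
  congr 1
  congr 1
  ext i
  rw [PiLp.smul_apply, smul_eq_mul, ← Complex.ofReal_mul, mul_inv_cancel_left₀ hx.ne']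

open Asymptotics Topology Filter in
theorem ep_mellin (F : ℝ → ℂ) (C P0 : ℂ) (a : ℝ) (ha : 0 < a) (hF : ContinuousOn F (Set.Ioi 0))
    (htop : F =O[atTop] fun t : ℝ => Real.exp (-(1 / 2) * t))
    (hbot : ∀ M : ℕ, (fun t : ℝ => F t - (C * (t : ℂ) ^ (-(a : ℂ)) - P0)) =O[𝓝[>] (0 : ℝ)]
      fun t => t ^ M) :
    ∃ E : ℂ → ℂ, Differentiable ℂ E ∧ ∀ w : ℂ, a < w.re →
      mellin F w = E w + C / (w - a) - P0 / w := by
  let J1 : ℝ → ℂ := Set.indicator (Set.Ioc 0 1) (fun t => (t : ℂ) ^ (-(a : ℂ)))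
  let J0 : ℝ → ℂ := Set.indicator (Set.Ioc 0 1) (fun _ => 1)
  let J : ℝ → ℂ := fun t => C • J1 t - P0 • J0 t
  have hJ1 : LocallyIntegrableOn J1 (Set.Ioi 0) := by
    have h : LocallyIntegrableOn (fun t : ℝ => (t : ℂ) ^ (-(a : ℂ))) (Set.Ioi 0) := by
      refine ContinuousOn.locallyIntegrableOn ?_ measurableSet_Ioi
      intro t ht
      refine ContinuousAt.continuousWithinAt ?_
      exact Complex.continuousAt_ofReal_cpow_const _ _ (Or.inr (ne_of_gt ht))
    intro x hx
    obtain ⟨U, hU, h⟩ := h x hx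
    exact ⟨U, hU, h.indicator measurableSet_Ioc⟩
  have hJ0 : LocallyIntegrableOn J0 (Set.Ioi 0) := by
    have h : LocallyIntegrableOn (fun t : ℝ => (1 : ℂ)) (Set.Ioi 0) :=
      ContinuousOn.locallyIntegrableOn continuousOn_const measurableSet_Ioi
    intro x hx
    obtain ⟨U, hU, h⟩ := h x hx
    exact ⟨U, hU, h.indicator measurableSet_Ioc⟩
  have hJ : LocallyIntegrableOn J (Set.Ioi 0) := (hJ1.smul C).sub (hJ0.smul P0)
  have hFl : LocallyIntegrableOn F (Set.Ioi 0) := hF.locallyIntegrableOn measurableSet_Ioi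
  let F1 : ℝ → ℂ := fun t => F t - J t
  have hF1l : LocallyIntegrableOn F1 (Set.Ioi 0) := hFl.sub hJ
  have hF1top : F1 =O[atTop] fun t : ℝ => Real.exp (-(1 / 2) * t) := by
    refine htop.congr' ?_ EventuallyEq.rfl
    filter_upwards [eventually_gt_atTop 1] with t ht
    have : t ∉ Set.Ioc (0 : ℝ) 1 := fun h => absurd h.2 (not_le.mpr ht)
    simp [F1, J, J1, J0, Set.indicator_of_notMem this]
  have hF1bot : ∀ M : ℕ, F1 =O[𝓝[>] (0 : ℝ)] fun t => t ^ (-(-(M : ℝ))) := by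
    intro M
    refine (hbot M).congr' ?_ ?_
    · filter_upwards [Ioc_mem_nhdsGT (zero_lt_one' ℝ)] with t ht
      simp [F1, J, J1, J0, Set.indicator_of_mem ht]
    · refine Eventually.of_forall fun t => ?_
      simp
  have hconv : ∀ w : ℂ, MellinConvergent F1 w ∧ DifferentiableAt ℂ (mellin F1) w := by
    intro w
    obtain ⟨M, hM⟩ := exists_nat_gt (-w.re)
    exact ⟨mellinConvergent_of_isBigO_rpow_exp (by norm_num) hF1l hF1top (hF1bot M) (by linarith),
      mellin_differentiableAt_of_isBigO_rpow_exp (by norm_num) hF1l hF1top (hF1bot M) (by linarith)⟩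
  refine ⟨mellin F1, fun w => (hconv w).2, fun w hw => ?_⟩
  have m1 := hasMellin_cpow_Ioc (-(a : ℂ)) (s := w) (by simp; exact hw)
  have m0 := hasMellin_one_Ioc (s := w) (by linarith)
  have m1' := hasMellin_const_smul m1.1 C
  have m0' := hasMellin_const_smul m0.1 P0
  have mJ := hasMellin_sub m1'.1 m0'.1
  have mF := hasMellin_add (hconv w).1 mJ.1
  have : F = fun t => F1 t + J t := by ext t; simp [F1]
  rw [this]
  refine mF.2.trans ?_
  rw [mJ.2, m1'.2, m0'.2, m1.2, m0.2]
  simp only [smul_eq_mul]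
  ring

open Asymptotics Topology Filter in
theorem ep_F {n p : ℕ} (hn : 0 < n) {P : MvPolynomial (Fin n) ℂ} (hP : P.IsHomogeneous p) :
    ∃ E : ℂ → ℂ, Differentiable ℂ E ∧ ∀ w : ℂ, ((n : ℝ) + p) / 2 < w.re →
      mellin (fun t => ∑' k : {k : Fin n → ℤ // k ≠ 0},
        MvPolynomial.eval (fun i => ((k : Fin n → ℤ) i : ℂ)) P *
          (Real.exp (-(∑ i, (((k : Fin n → ℤ) i : ℝ)) ^ 2) * t) : ℂ)) w =
        E w + (∫ x : Fin n → ℝ, MvPolynomial.eval (fun i => (x i : ℂ)) P *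
          (Real.exp (-∑ i, x i ^ 2) : ℂ)) / (w - (((n : ℝ) + p) / 2 : ℝ)) -
          MvPolynomial.eval (fun _ => 0) P / w := by
  have hn' : (0 : ℝ) < n := by exact_mod_cast hn
  have hn1 : (0 : ℝ) < (n : ℝ) + p := by positivity
  have hs : ∀ a : ℝ, 0 < a → Summable fun k : {k : Fin n → ℤ // k ≠ 0} =>
      ‖MvPolynomial.eval (fun i => ((k : Fin n → ℤ) i : ℂ)) P‖ *
        Real.exp (-(∑ i, (((k : Fin n → ℤ) i : ℝ)) ^ 2) * a) := fun a ha =>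
    (ep_summ_exp hP a ha).comp_injective (Subtype.val_injective (p := fun k : Fin n → ℤ => k ≠ 0))
  have hnorm : ∀ (z : ℂ) (x : ℝ), ‖z * (Real.exp x : ℂ)‖ = ‖z‖ * Real.exp x := fun z x => by
    rw [norm_mul, Complex.norm_real, Real.norm_of_nonneg (Real.exp_pos _).le]
  refine ep_mellin _ _ _ (((n : ℝ) + p) / 2) (by positivity) ?_ ?_ ?_
  · intro t0 ht0
    have ht0 : 0 < t0 := ht0
    refine ContinuousAt.continuousWithinAt ?_
    refine ContinuousOn.continuousAt (s := Set.Ioi (t0 / 2)) ?_ (Ioi_mem_nhds (by linarith))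
    refine continuousOn_tsum (fun k => ?_) (hs (t0 / 2) (by linarith)) fun k t ht => ?_
    · exact Continuous.continuousOn (by fun_prop)
    · rw [hnorm]
      have ht : t0 / 2 < t := ht
      have := ep_R_ge_one k.2
      gcongr ?_ * Real.exp ?_
      nlinarith
  · refine IsBigO.of_bound (∑' k : {k : Fin n → ℤ // k ≠ 0},
      ‖MvPolynomial.eval (fun i => ((k : Fin n → ℤ) i : ℂ)) P‖ *
        Real.exp (-(∑ i, (((k : Fin n → ℤ) i : ℝ)) ^ 2) * (1 / 2))) ?_
    filter_upwards [eventually_ge_atTop 1] with t ht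
    rw [Real.norm_of_nonneg (Real.exp_pos _).le, ← tsum_mul_right]
    refine tsum_of_norm_bounded ((hs (1 / 2) (by norm_num)).mul_right _).hasSum fun k => ?_
    rw [hnorm, mul_assoc, ← Real.exp_add]
    have := ep_R_ge_one k.2
    gcongr ?_ * Real.exp ?_
    nlinarith
  · intro M
    have hsq : Tendsto Real.sqrt (𝓝[>] 0) (𝓝[>] 0) := by
      refine tendsto_nhdsWithin_iff.mpr ⟨?_, ?_⟩
      · have := Real.continuous_sqrt.tendsto 0
        rw [Real.sqrt_zero] at this
        exact this.mono_left nhdsWithin_le_nhds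
      · filter_upwards [self_mem_nhdsWithin] with t ht
        exact Real.sqrt_pos.mpr ht
    have h1 := (ep_asymp hP (2 * M + (n + p))).comp_tendsto hsq
    obtain ⟨c, hc⟩ := h1.bound
    refine IsBigO.of_bound c ?_
    filter_upwards [hc, self_mem_nhdsWithin] with t htc ht
    have ht : 0 < t := ht
    simp only [Function.comp_apply, Real.sq_sqrt ht.le] at htc
    have hsum : Summable fun k : Fin n → ℤ => MvPolynomial.eval (fun i => (k i : ℂ)) P *
        (Real.exp (-(∑ i, (k i : ℝ) ^ 2) * t) : ℂ) := by
      refine Summable.of_norm ?_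
      simpa only [hnorm] using ep_summ_exp hP t ht
    have hgen : ∀ f : (Fin n → ℤ) → ℂ, Summable f →
        ∑' k, f k = f 0 + ∑' k : {k : Fin n → ℤ // k ≠ 0}, f k := fun f hf => by
      rw [← hf.tsum_subtype_add_tsum_subtype_compl {(0 : Fin n → ℤ)}, tsum_singleton]
      rfl
    have h00 : MvPolynomial.eval (fun i => (((0 : Fin n → ℤ) i : ℤ) : ℂ)) P *
        (Real.exp (-(∑ i, (((0 : Fin n → ℤ) i : ℤ) : ℝ) ^ 2) * t) : ℂ) =
        MvPolynomial.eval (fun _ => 0) P := by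
      simp
    rw [hgen _ hsum, h00] at htc
    have hpos : 0 < Real.sqrt t := Real.sqrt_pos.mpr ht
    have hpow : ((Real.sqrt t : ℝ) : ℂ) ^ (n + p) * (t : ℂ) ^ (-((((n : ℝ) + p) / 2 : ℝ) : ℂ)) = 1 := by
      rw [← Complex.ofReal_neg, ← Complex.ofReal_cpow ht.le, ← Complex.ofReal_pow,
        ← Complex.ofReal_mul, Real.sqrt_eq_rpow, ← Real.rpow_natCast, ← Real.rpow_mul ht.le,
        ← Real.rpow_add ht]
      push_cast
      rw [show (1 / 2 * ((n : ℝ) + p) + -(((n : ℝ) + p) / 2)) = 0 by ring, Real.rpow_zero]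
      simp
    have hR : ‖(((Real.sqrt t : ℝ) : ℂ)) ^ (n + p)‖ = Real.sqrt t ^ (n + p) := by
      rw [norm_pow, Complex.norm_real, Real.norm_of_nonneg hpos.le]
    have hpp : 0 < Real.sqrt t ^ (n + p) := by positivity
    refine le_of_mul_le_mul_left ?_ hpp
    rw [Real.norm_of_nonneg (by positivity)] at htc ⊢
    refine le_trans (le_of_eq ?_) (htc.trans (le_of_eq ?_))
    · rw [← hR, ← norm_mul]
      congr 1
      rw [mul_sub, mul_sub, mul_left_comm _ _ ((t : ℂ) ^ _), hpow, mul_one, mul_add]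
      ring
    · rw [pow_add, pow_mul, Real.sq_sqrt ht.le]
      ring

theorem epstein_meromorphic {n p : ℕ} (hn : 0 < n)
    (P : MvPolynomial (Fin n) ℂ) (hP : P.IsHomogeneous p) :
    ∃ G : ℂ → ℂ, Differentiable ℂ G ∧
      (∀ s : ℂ, (n : ℝ) + (p : ℝ) < s.re →
        (∑' k : {k : Fin n → ℤ // k ≠ 0},
          MvPolynomial.eval (fun i => ((k : Fin n → ℤ) i : ℂ)) P /
            ((Real.sqrt (∑ i, (((k : Fin n → ℤ) i : ℝ)) ^ 2) : ℂ) ^ s)) =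
          G s + (∫ u : Metric.sphere (0 : EuclideanSpace ℝ (Fin n)) 1,
              MvPolynomial.eval (fun i => ((u : EuclideanSpace ℝ (Fin n)) i : ℂ)) P
                ∂((volume : Measure (EuclideanSpace ℝ (Fin n))).toSphere)) /
            (s - ((n : ℂ) + (p : ℂ)))) := by
  obtain ⟨E, hE, hEF⟩ := ep_F hn hP
  rw [ep_polar hn hP] at hEF
  have hn' : (0 : ℝ) < n := by exact_mod_cast hn
  have hn1 : (0 : ℝ) < (n : ℝ) + p := by positivity
  set S : ℂ := ∫ u : Metric.sphere (0 : EuclideanSpace ℝ (Fin n)) 1,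
              MvPolynomial.eval (fun i => ((u : EuclideanSpace ℝ (Fin n)) i : ℂ)) P
                ∂((volume : Measure (EuclideanSpace ℝ (Fin n))).toSphere)
  set P0 := MvPolynomial.eval (fun _ => (0 : ℂ)) P
  set s0 : ℂ := (n : ℂ) + p
  have hs0 : s0.re = (n : ℝ) + p := by simp [s0]
  have hG0 : Gamma (s0 / 2) ≠ 0 := Gamma_ne_zero_of_re_pos (by
    rw [show s0 / 2 = ((((n : ℝ) + p) / 2 : ℝ) : ℂ) by simp [s0], Complex.ofReal_re]
    positivity)
  let φ : ℂ → ℂ := fun s => (Gamma (s / 2))⁻¹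
  have hφ : Differentiable ℂ φ :=
    Complex.differentiable_one_div_Gamma.comp (differentiable_id.div_const 2)
  have hφ1 : Differentiable ℂ (fun s : ℂ => (Gamma (s / 2 + 1))⁻¹) :=
    Complex.differentiable_one_div_Gamma.comp ((differentiable_id.div_const 2).add_const 1)
  have hd : Differentiable ℂ (dslope φ s0) := by
    rw [← differentiableOn_univ, Complex.differentiableOn_dslope Filter.univ_mem]
    exact hφ.differentiableOn
  refine ⟨fun s => φ s * E (s / 2) + S * Gamma (s0 / 2) * dslope φ s0 s -
    P0 * (Gamma (s / 2 + 1))⁻¹, ?_, fun s hs => ?_⟩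
  · exact ((hφ.mul (hE.comp (differentiable_id.div_const 2))).add (hd.const_mul _)).sub
      (hφ1.const_mul _)
  · have hre : (s / 2).re = s.re / 2 := by
      rw [show s / 2 = s / ((2 : ℝ) : ℂ) by simp, Complex.div_ofReal_re]
    have hw : ((n : ℝ) + p) / 2 < (s / 2).re := by rw [hre]; linarith
    have hw0 : 0 < (s / 2).re := by rw [hre]; linarith
    have hG : Gamma (s / 2) ≠ 0 := Gamma_ne_zero_of_re_pos hw0
    have hss : s - s0 ≠ 0 := by
      intro h
      have : (s - s0).re = 0 := by rw [h]; simp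
      rw [Complex.sub_re, hs0] at this
      linarith
    have hs00 : s / 2 ≠ 0 := by
      intro h
      rw [h] at hw0
      simp at hw0
    have hsum := hasSum_mellin (ι := {k : Fin n → ℤ // k ≠ 0})
      (a := fun k => MvPolynomial.eval (fun i => ((k : Fin n → ℤ) i : ℂ)) P)
      (p := fun k => ∑ i, (((k : Fin n → ℤ) i : ℝ)) ^ 2)
      (F := fun t => ∑' k : {k : Fin n → ℤ // k ≠ 0},
        MvPolynomial.eval (fun i => ((k : Fin n → ℤ) i : ℂ)) P *
          (Real.exp (-(∑ i, (((k : Fin n → ℤ) i : ℝ)) ^ 2) * t) : ℂ)) (s := s / 2)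
      (fun k => Or.inr (lt_of_lt_of_le one_pos (ep_R_ge_one k.2))) hw0
      (fun t ht => by
        refine Summable.hasSum (Summable.of_norm ?_)
        have := (ep_summ_exp hP t ht).comp_injective
          (Subtype.val_injective (p := fun k : Fin n → ℤ => k ≠ 0))
        refine this.congr fun k => ?_
        rw [norm_mul, Complex.norm_real, Real.norm_of_nonneg (Real.exp_pos _).le]
        rfl)
      (ep_summ hP _ (by rw [hre]; linarith))
    rw [hEF _ hw] at hsum
    have hpw : ∀ k : {k : Fin n → ℤ // k ≠ 0},
        MvPolynomial.eval (fun i => ((k : Fin n → ℤ) i : ℂ)) P /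
            ((Real.sqrt (∑ i, (((k : Fin n → ℤ) i : ℝ)) ^ 2) : ℂ) ^ s) =
        (Gamma (s / 2))⁻¹ * (Gamma (s / 2) * MvPolynomial.eval (fun i => ((k : Fin n → ℤ) i : ℂ)) P /
          ((∑ i, (((k : Fin n → ℤ) i : ℝ)) ^ 2 : ℝ) : ℂ) ^ (s / 2)) := by
      intro k
      have h1 : (0 : ℝ) ≤ ∑ i, (((k : Fin n → ℤ) i : ℝ)) ^ 2 := zero_le_one.trans (ep_R_ge_one k.2)
      have h2 : ((∑ i, (((k : Fin n → ℤ) i : ℝ)) ^ 2 : ℝ) : ℂ) ^ (s / 2) =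
          (Real.sqrt (∑ i, (((k : Fin n → ℤ) i : ℝ)) ^ 2) : ℂ) ^ s := by
        conv_lhs => rw [← Real.sq_sqrt h1]
        rw [sq, Complex.ofReal_mul, Complex.mul_cpow_ofReal_nonneg (Real.sqrt_nonneg _)
          (Real.sqrt_nonneg _)]
        rw [← Complex.cpow_add _ _ (by
          rw [Complex.ofReal_ne_zero]
          exact (Real.sqrt_pos.mpr (lt_of_lt_of_le one_pos (ep_R_ge_one k.2))).ne')]
        congr 1
        ring
      rw [h2, mul_div_assoc, inv_mul_cancel_left₀ hG]
    rw [tsum_congr hpw, (hsum.mul_left _).tsum_eq]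
    have hds : dslope φ s0 s = (s - s0)⁻¹ * ((Gamma (s / 2))⁻¹ - (Gamma (s0 / 2))⁻¹) := by
      rw [dslope_of_ne _ (sub_ne_zero.mp hss), slope_def_field]
      simp only [φ]
      rw [div_eq_inv_mul]
    simp only [hds, φ]
    rw [Complex.Gamma_add_one _ hs00]
    have h3 : s / 2 - ((((n : ℝ) + p) / 2 : ℝ) : ℂ) = (s - s0) / 2 := by
      simp only [s0]; push_cast; ring
    rw [h3]
    have hs' : s ≠ 0 := fun h => hs00 (by simp [h])
    field_simp
    ring
end

section
/- The function s ↦ ∑_{k ∈ ℤ², k≠0} k_i k_j / ‖k‖^{s+4} (defined for Re(s) > 0) has a meromorphic continuation with a simple pole at s = 0 with residue δ_{ij}·π. -/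
open Complex

namespace EpsteinAux

open Filter Topology Asymptotics Set MeasureTheory HurwitzZeta

/-- The squared Jacobi theta function. -/
noncomputable def th2 (t : ℝ) : ℂ := ((evenKernel 0 t : ℝ) : ℂ) ^ 2

/-- The squared norm. -/
def q (k : Fin 2 → ℤ) : ℝ := ∑ l, ((k l : ℝ)) ^ 2

lemma th2_int : LocallyIntegrableOn th2 (Ioi 0) :=
  ((continuous_ofReal.comp_continuousOn (continuousOn_evenKernel 0)).pow 2).locallyIntegrableOn
    measurableSet_Ioi

lemma th2_feq (x : ℝ) (hx : x ∈ Ioi 0) :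
    th2 (1 / x) = ((1 : ℂ) * ((x ^ (1 : ℝ) : ℝ) : ℂ)) • th2 x := by
  have hx' : (0 : ℝ) < x := hx
  have h := evenKernel_functional_equation 0 (1 / x)
  rw [← evenKernel_eq_cosKernel_of_zero, one_div_one_div] at h
  have hs : (x ^ (1 / 2 : ℝ)) ^ 2 = x := by
    rw [← Real.sqrt_eq_rpow, Real.sq_sqrt hx'.le]
  have h2 : (evenKernel 0 (1 / x)) ^ 2 = x * (evenKernel 0 x) ^ 2 := by
    rw [h, mul_pow, one_div x, Real.inv_rpow hx'.le, one_div, inv_inv, hs]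
  unfold th2
  rw [← ofReal_pow, h2]
  simp

lemma th2_top (r : ℝ) : (fun t => th2 t - 1) =O[atTop] (fun t : ℝ => t ^ r) := by
  obtain ⟨v, hv, hv'⟩ := isBigO_atTop_evenKernel_sub 0
  simp only [if_true] at hv'
  have h0 : (fun t : ℝ => evenKernel 0 t - 1) =O[atTop] (fun t : ℝ => t ^ r) :=
    hv'.trans (isLittleO_exp_neg_mul_rpow_atTop hv _).isBigO
  have h1 : (fun t : ℝ => evenKernel 0 t - 1) =O[atTop] (fun _ : ℝ => (1 : ℝ)) := by
    have := hv'.trans (isLittleO_exp_neg_mul_rpow_atTop hv 0).isBigO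
    simpa using this
  have h2 : (fun t : ℝ => evenKernel 0 t + 1) =O[atTop] (fun _ : ℝ => (1 : ℝ)) := by
    have := h1.add (isBigO_refl (fun _ : ℝ => (2 : ℝ)) atTop |>.trans
      (isBigO_const_const (2 : ℝ) (one_ne_zero) atTop))
    refine this.congr_left fun t => ?_
    ring
  have h3 := h0.mul h2
  have h4 : (fun t => th2 t - 1) = fun t =>
      (((evenKernel 0 t - 1) * (evenKernel 0 t + 1) : ℝ) : ℂ) := by
    ext t
    unfold th2
    push_cast
    ring
  rw [h4, ← isBigO_norm_left]
  simp only [norm_real]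
  rw [isBigO_norm_left]
  simpa using h3

/-- The functional equation pair. -/
noncomputable def pair : WeakFEPair ℂ where
  f := th2
  g := th2
  k := 1
  ε := 1
  f₀ := 1
  g₀ := 1
  hf_int := th2_int
  hg_int := th2_int
  hk := one_pos
  hε := one_ne_zero
  h_feq := th2_feq
  hf_top := th2_top
  hg_top := th2_top

lemma q_eq (k : Fin 2 → ℤ) : q k = (k 0 : ℝ) ^ 2 + (k 1 : ℝ) ^ 2 := by
  simp [q, Fin.sum_univ_two]

lemma q_nonneg (k : Fin 2 → ℤ) : 0 ≤ q k := by rw [q_eq]; positivity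

lemma norm_sq_le (k : Fin 2 → ℤ) : ‖k‖ ^ 2 ≤ q k := by
  have h : ‖k‖ ≤ Real.sqrt (q k) := by
    rw [pi_norm_le_iff_of_nonneg (Real.sqrt_nonneg _)]
    intro i
    apply Real.le_sqrt_of_sq_le
    rw [Int.norm_eq_abs, sq_abs, q_eq]
    fin_cases i
    · simp; positivity
    · simp; positivity
  calc ‖k‖ ^ 2 ≤ (Real.sqrt (q k)) ^ 2 := by gcongr
    _ = q k := Real.sq_sqrt (q_nonneg k)

lemma q_pos {k : Fin 2 → ℤ} (hk : k ≠ 0) : 0 < q k :=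
  lt_of_lt_of_le (by have := norm_pos_iff.mpr hk; positivity) (norm_sq_le k)

/-- The coefficient. -/
noncomputable def a (k : Fin 2 → ℤ) : ℂ := if k = 0 then 0 else 1

lemma theta_sum (t : ℝ) (ht : t ∈ Ioi 0) :
    HasSum (fun k : Fin 2 → ℤ => a k * (Real.exp (-Real.pi * q k * t) : ℝ)) (th2 t - 1) := by
  have h1 := hasSum_int_evenKernel 0 (t := t) ht
  simp only [add_zero, QuotientAddGroup.mk_zero] at h1
  have h1n : Summable fun n : ℤ => ‖Real.exp (-Real.pi * (n : ℝ) ^ 2 * t)‖ := h1.summable.norm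
  have h2 := h1.mul h1 (summable_mul_of_summable_norm h1n h1n)
  have h3 : HasSum (fun k : Fin 2 → ℤ => Real.exp (-Real.pi * q k * t))
      (evenKernel 0 t * evenKernel 0 t) := by
    rw [← (finTwoArrowEquiv ℤ).symm.hasSum_iff]
    refine h2.congr_fun fun p => ?_
    simp only [Function.comp, finTwoArrowEquiv_symm_apply, q_eq, ← Real.exp_add]
    congr 1
    simp
    ring
  have h4 := hasSum_ite_sub_hasSum (hasSum_ofReal.mpr h3) 0
  have h5 : th2 t - 1 = ((evenKernel 0 t * evenKernel 0 t : ℝ) : ℂ) -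
      ((Real.exp (-Real.pi * q 0 * t) : ℝ) : ℂ) := by
    simp [th2, q_eq, sq]
  rw [h5]
  refine h4.congr_fun fun k => ?_
  by_cases hk : k = 0 <;> simp [a, hk]

lemma summ {σ : ℝ} (hσ : 1 < σ) : Summable fun k : Fin 2 → ℤ => ‖a k‖ / (q k) ^ σ := by
  refine Summable.of_nonneg_of_le (fun k => ?_) (fun k => ?_)
    (EisensteinSeries.summable_one_div_norm_rpow (k := 2 * σ) (by linarith))
  · have := q_nonneg k
    positivity
  · by_cases hk : k = 0
    · simp only [a, hk, if_true, norm_zero, zero_div]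
      positivity
    · have hn : 0 < ‖k‖ := norm_pos_iff.mpr hk
      simp only [a, hk, if_false, norm_one]
      rw [Real.rpow_neg hn.le, one_div, Real.rpow_mul hn.le]
      apply inv_anti₀ (by positivity)
      apply Real.rpow_le_rpow (by positivity) _ (by linarith)
      rw [Real.rpow_two]
      exact norm_sq_le k

lemma mellin_sum {u : ℂ} (hu : 1 < u.re) :
    HasSum (fun k : Fin 2 → ℤ => (Real.pi : ℂ) ^ (-u) * Gamma u * a k / (q k : ℂ) ^ u)
      (pair.Λ u) := by
  have := (pair.hasMellin (s := u) hu).2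
  rw [← this]
  refine hasSum_mellin_pi_mul (fun k => ?_) (by linarith) theta_sum (summ hu)
  by_cases hk : k = 0
  · simp [a, hk]
  · exact Or.inr (q_pos hk)

lemma zeta_sum {u : ℂ} (hu : 1 < u.re) :
    HasSum (fun k : Fin 2 → ℤ => a k / (q k : ℂ) ^ u)
      ((Real.pi : ℂ) ^ u * (Gamma u)⁻¹ * pair.Λ u) := by
  have h := (mellin_sum hu).mul_left ((Real.pi : ℂ) ^ u * (Gamma u)⁻¹)
  refine h.congr_fun fun k => ?_
  have hG : Gamma u ≠ 0 := Gamma_ne_zero_of_re_pos (by linarith)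
  have hpi : (Real.pi : ℂ) ≠ 0 := ofReal_ne_zero.mpr Real.pi_ne_zero
  have hp : (Real.pi : ℂ) ^ u ≠ 0 := by simp [cpow_eq_zero_iff, hpi]
  rw [cpow_neg]
  field_simp

/-- The summand. -/
noncomputable def T (i j : Fin 2) (s : ℂ) (k : Fin 2 → ℤ) : ℂ :=
  ((k i : ℂ) * (k j : ℂ)) / ((Real.sqrt (q k) : ℂ) ^ (s + 4))

lemma T_diag_sum {s : ℂ} (hs : 0 < s.re) (k : Fin 2 → ℤ) :
    T 0 0 s k + T 1 1 s k = a k / (q k : ℂ) ^ ((s + 2) / 2) := by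
  by_cases hk : k = 0
  · simp [T, a, hk]
  have hq := q_pos hk
  have hqc : (q k : ℂ) ≠ 0 := ofReal_ne_zero.mpr hq.ne'
  have h1 : (Real.sqrt (q k) : ℂ) ^ (s + 4) = (q k : ℂ) ^ ((s + 2) / 2) * (q k : ℂ) := by
    have hr : (Real.sqrt (q k) : ℂ) ^ (2 : ℂ) = (q k : ℂ) := by
      rw [cpow_ofNat, ← ofReal_pow, Real.sq_sqrt hq.le]
    have hr0 : (Real.sqrt (q k) : ℂ) ≠ 0 := ofReal_ne_zero.mpr (Real.sqrt_pos.mpr hq).ne'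
    have h5 : (q k : ℂ) ^ ((s + 2) / 2) = (Real.sqrt (q k) : ℂ) ^ (s + 2) := by
      conv_lhs => rw [← Real.mul_self_sqrt hq.le, ofReal_mul,
        mul_cpow_ofReal_nonneg (Real.sqrt_nonneg _) (Real.sqrt_nonneg _), ← cpow_add _ _ hr0]
      congr 1
      ring
    rw [h5, show s + 4 = (s + 2) + 2 by ring, cpow_add _ _ hr0, hr]
  have h2 : (q k : ℂ) ^ ((s + 2) / 2) ≠ 0 := by simp [cpow_eq_zero_iff, hqc]
  have h3 : (q k : ℂ) = (k 0 : ℂ) * k 0 + (k 1 : ℂ) * k 1 := by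
    rw [q_eq]; push_cast; ring
  simp only [T, h1, a, hk, if_false]
  rw [← add_div, ← h3]
  field_simp

lemma T_summable {s : ℂ} (hs : 0 < s.re) (i : Fin 2) : Summable (T i i s) := by
  have hu : 1 < ((s + 2) / 2).re := by simp; linarith
  refine Summable.of_norm_bounded (zeta_sum hu).summable.norm fun k => ?_
  rw [← T_diag_sum hs k]
  have h3 : ∀ x y : ℤ, ‖(x : ℂ) * x + (y : ℂ) * y‖ = (x : ℝ) * x + (y : ℝ) * y := by
    intro x y
    rw [show (x : ℂ) * x + (y : ℂ) * y = (((x : ℝ) * x + (y : ℝ) * y : ℝ) : ℂ) by push_cast; rfl,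
      norm_real, Real.norm_of_nonneg (by nlinarith [mul_self_nonneg (x : ℝ), mul_self_nonneg (y : ℝ)])]
  have h4 : ∀ x : ℤ, ‖(x : ℂ) * x‖ = (x : ℝ) * x := by
    intro x
    simpa using h3 x 0
  simp only [T]
  rw [← add_div, norm_div, norm_div, h3, h4]
  gcongr
  fin_cases i
  · simpa using mul_self_nonneg (k 1 : ℝ)
  · simpa using mul_self_nonneg (k 0 : ℝ)

lemma T_swap (s : ℂ) : ∑' k, T 0 0 s k = ∑' k, T 1 1 s k := by
  rw [← ((Equiv.swap (0 : Fin 2) 1).arrowCongr (Equiv.refl ℤ)).tsum_eq]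
  refine tsum_congr fun k => ?_
  simp [T, q_eq, add_comm]

lemma T_diag {s : ℂ} (hs : 0 < s.re) (i : Fin 2) :
    ∑' k, T i i s k = 1 / 2 * ((Real.pi : ℂ) ^ ((s + 2) / 2) * (Gamma ((s + 2) / 2))⁻¹ *
      pair.Λ ((s + 2) / 2)) := by
  have hu : 1 < ((s + 2) / 2).re := by simp; linarith
  rw [← (zeta_sum hu).tsum_eq]
  simp_rw [← T_diag_sum hs]
  rw [(T_summable hs 0).tsum_add (T_summable hs 1)]
  have := T_swap s
  fin_cases i
  · simp only [Fin.zero_eta]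
    rw [← this]; ring
  · simp only [Fin.mk_one]
    rw [← this]; ring

/-- Reflection in the second coordinate. -/
def refl2 : (Fin 2 → ℤ) ≃ (Fin 2 → ℤ) :=
  Function.Involutive.toPerm (fun k => ![k 0, - k 1]) (by
    intro k; ext l; fin_cases l <;> simp)

lemma T_off01 (s : ℂ) : ∑' k, T 0 1 s k = 0 := by
  have h := refl2.tsum_eq (T 0 1 s)
  have h2 : ∀ k, T 0 1 s (refl2 k) = - T 0 1 s k := by
    intro k
    have e : refl2 k = ![k 0, - k 1] := rfl
    rw [e]
    simp [T, q_eq, neg_div]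
  simp_rw [h2] at h
  rw [tsum_neg] at h
  exact CharZero.neg_eq_self_iff.mp h

lemma T_off (s : ℂ) {i j : Fin 2} (hij : i ≠ j) : ∑' k, T i j s k = 0 := by
  have h : ∀ k, T 1 0 s k = T 0 1 s k := fun k => by simp [T, mul_comm]
  fin_cases i <;> fin_cases j
  · simp at hij
  · exact T_off01 s
  · simpa [h] using T_off01 s
  · simp at hij

/-- The function `π^u / Γ(u)` at `u = (s+2)/2`. -/
noncomputable def H (s : ℂ) : ℂ := (Real.pi : ℂ) ^ ((s + 2) / 2) * (Gamma ((s + 2) / 2))⁻¹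

lemma H_diff : Differentiable ℂ H := by
  have hpi : (Real.pi : ℂ) ≠ 0 := ofReal_ne_zero.mpr Real.pi_ne_zero
  have h1 : Differentiable ℂ fun s : ℂ => (s + 2) / 2 := by fun_prop
  exact (h1.const_cpow (Or.inl hpi)).mul (differentiable_one_div_Gamma.comp h1)

/-- The entire part. -/
noncomputable def G (s : ℂ) : ℂ :=
  1 / 2 * (H s * pair.Λ₀ ((s + 2) / 2)) -
    1 / 2 * ((Real.pi : ℂ) ^ ((s + 2) / 2) * (Gamma ((s + 2) / 2 + 1))⁻¹) + dslope H 0 s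

lemma G_diff : Differentiable ℂ G := by
  have hpi : (Real.pi : ℂ) ≠ 0 := ofReal_ne_zero.mpr Real.pi_ne_zero
  have h1 : Differentiable ℂ fun s : ℂ => (s + 2) / 2 := by fun_prop
  have h2 : Differentiable ℂ fun s : ℂ => (s + 2) / 2 + 1 := by fun_prop
  have h3 : Differentiable ℂ (dslope H 0) := by
    rw [← differentiableOn_univ, Complex.differentiableOn_dslope Filter.univ_mem]
    exact H_diff.differentiableOn
  refine Differentiable.add (Differentiable.sub ?_ ?_) h3
  · exact (H_diff.mul (pair.differentiable_Λ₀.comp h1)).const_mul _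
  · exact ((h1.const_cpow (Or.inl hpi)).mul (differentiable_one_div_Gamma.comp h2)).const_mul _

lemma G_eq {s : ℂ} (hs : 0 < s.re) :
    1 / 2 * ((Real.pi : ℂ) ^ ((s + 2) / 2) * (Gamma ((s + 2) / 2))⁻¹ *
      pair.Λ ((s + 2) / 2)) = G s + (Real.pi : ℂ) / s := by
  have hs0 : s ≠ 0 := by rintro rfl; simp at hs
  have hu : 1 < ((s + 2) / 2).re := by simp; linarith
  have hu0 : (s + 2) / 2 ≠ 0 := by intro h; rw [h] at hu; simp at hu; linarith
  have hs2 : s + 2 ≠ 0 := by intro h; simp [h] at hu0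
  have hG : Gamma ((s + 2) / 2) ≠ 0 := Gamma_ne_zero_of_re_pos (by linarith)
  have hH0 : H 0 = Real.pi := by simp [H]
  have hL : pair.Λ ((s + 2) / 2) = pair.Λ₀ ((s + 2) / 2) - 1 / ((s + 2) / 2) + 2 / s := by
    simp only [WeakFEPair.Λ, pair, smul_eq_mul, ofReal_one]
    have : (1 : ℂ) - (s + 2) / 2 = - (s / 2) := by ring
    rw [this]
    field_simp
    ring
  rw [hL, G, dslope_of_ne _ hs0, slope_def_field, hH0, Gamma_add_one _ hu0]
  simp only [H]
  field_simp
  ring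

end EpsteinAux

/-- `s ↦ ∑_{0 ≠ k ∈ ℤ²} k_i k_j ‖k‖^{−(s+4)}` continues meromorphically with a simple
pole at `s = 0` of residue `δ_{ij} π`. -/
theorem epstein_dim2_residue (i j : Fin 2) :
    ∃ G : ℂ → ℂ, Differentiable ℂ G ∧
      ∀ s : ℂ, 0 < s.re →
        (∑' k : {k : Fin 2 → ℤ // k ≠ 0},
          (((k : Fin 2 → ℤ) i : ℂ) * ((k : Fin 2 → ℤ) j : ℂ)) /
            ((Real.sqrt (∑ l, (((k : Fin 2 → ℤ) l : ℝ)) ^ 2) : ℂ) ^ (s + 4))) =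
          G s + (if i = j then (Real.pi : ℂ) else 0) / s := by
  have key : ∀ s : ℂ, (∑' k : {k : Fin 2 → ℤ // k ≠ 0},
          (((k : Fin 2 → ℤ) i : ℂ) * ((k : Fin 2 → ℤ) j : ℂ)) /
            ((Real.sqrt (∑ l, (((k : Fin 2 → ℤ) l : ℝ)) ^ 2) : ℂ) ^ (s + 4))) =
          ∑' k, EpsteinAux.T i j s k := by
    intro s
    refine tsum_subtype_eq_of_support_subset (f := EpsteinAux.T i j s)
      (s := {k : Fin 2 → ℤ | k ≠ 0}) ?_
    intro k hk
    rintro rfl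
    simp [EpsteinAux.T] at hk
  by_cases hij : i = j
  · subst hij
    refine ⟨EpsteinAux.G, EpsteinAux.G_diff, fun s hs => ?_⟩
    rw [key, EpsteinAux.T_diag hs, EpsteinAux.G_eq hs, if_pos rfl]
  · refine ⟨fun _ => 0, differentiable_const _, fun s hs => ?_⟩
    rw [key, EpsteinAux.T_off s hij, if_neg hij]
    simp
end

section
/- The Epstein zeta function Z_n(s) = ∑_{k ∈ ℤⁿ, k≠0} ‖k‖^{−s}, convergent for Re(s) > n, extends meromorphically to ℂ with a single simple pole at s = n of residue 2π^{n/2}/Γ(n/2), and Z_n(0) = −1. -/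
open Complex

lemma epstein_hasSum_prod {f : ℤ → ℝ} {a : ℝ} (hf : ∀ i, 0 ≤ f i) (h : HasSum f a) (n : ℕ) :
    HasSum (fun k : Fin n → ℤ ↦ ∏ i, f (k i)) (a ^ n) := by
  induction n with
  | zero => simp
  | succ n ih =>
    have hg : (0 : (Fin n → ℤ) → ℝ) ≤ fun k : Fin n → ℤ ↦ ∏ i, f (k i) :=
      fun k ↦ Finset.prod_nonneg fun i _ ↦ hf _
    have hs := Summable.mul_of_nonneg (f := f) (g := fun k : Fin n → ℤ ↦ ∏ i, f (k i))
      h.summable ih.summable hf hg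
    have h2 := h.mul ih hs
    rw [← (Fin.consEquiv (fun _ : Fin (n + 1) ↦ ℤ)).hasSum_iff, pow_succ']
    refine h2.congr_fun fun x ↦ ?_
    simp [Fin.consEquiv, Fin.prod_univ_succ]

lemma epstein_summable (n : ℕ) (σ : ℝ) (hσ : (n : ℝ) < σ) :
    Summable fun k : Fin n → ℤ ↦ (Real.sqrt (∑ i, ((k i : ℝ)) ^ 2)) ^ (-σ) := by
  let b := (EuclideanSpace.basisFun (Fin n) ℝ).toBasis
  let c := b.restrictScalars ℤ
  have hr : Module.finrank ℤ (Submodule.span ℤ (Set.range b)) = n := by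
    simpa using Module.finrank_eq_card_basis c
  have := ZLattice.summable_norm_rpow (Submodule.span ℤ (Set.range b)) (-σ) (by
    rw [hr]; linarith)
  refine (this.comp_injective c.equivFun.symm.injective).congr fun k ↦ ?_
  have h1 : ∀ i, ((c.equivFun.symm k : Submodule.span ℤ (Set.range b)) :
      EuclideanSpace ℝ (Fin n)) i = k i := by
    intro i
    have hc : ∀ j, ((c j : Submodule.span ℤ (Set.range b)) : EuclideanSpace ℝ (Fin n)) =
        EuclideanSpace.single j 1 := by
      intro j
      rw [Module.Basis.restrictScalars_apply]
      simp [b]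
    rw [Module.Basis.equivFun_symm_apply]
    simp [hc, Pi.single_apply]
  simp only [Function.comp_apply]
  congr 1
  rw [Submodule.coe_norm, EuclideanSpace.norm_eq]
  simp only [h1, Real.norm_eq_abs, sq_abs]

lemma epstein_top (n : ℕ) (r : ℝ) :
    (fun t : ℝ ↦ ((HurwitzZeta.evenKernel 0 t ^ n : ℝ) : ℂ) - 1) =O[Filter.atTop] (· ^ r) := by
  obtain ⟨p, hp, h⟩ := HurwitzZeta.isBigO_atTop_evenKernel_sub 0
  simp only [if_true] at h
  have hO : Asymptotics.IsBigO Filter.atTop (fun t ↦ HurwitzZeta.evenKernel 0 t - 1)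
      (fun t : ℝ ↦ t ^ r) := h.trans (isLittleO_exp_neg_mul_rpow_atTop hp r).isBigO
  have h0 : Filter.Tendsto (fun t ↦ HurwitzZeta.evenKernel 0 t - 1) Filter.atTop (nhds 0) :=
    h.trans_tendsto (by
      refine Real.tendsto_exp_atBot.comp ?_
      exact Filter.tendsto_id.const_mul_atTop_of_neg (neg_lt_zero.mpr hp))
  have h1 : Filter.Tendsto (fun t ↦ HurwitzZeta.evenKernel 0 t) Filter.atTop (nhds 1) := by
    simpa using h0.add_const 1
  have h2 : Filter.Tendsto (fun t ↦ ∑ i ∈ Finset.range n, HurwitzZeta.evenKernel 0 t ^ i)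
      Filter.atTop (nhds (∑ i ∈ Finset.range n, 1 ^ i)) :=
    tendsto_finsetSum _ fun i _ ↦ h1.pow i
  have h3 := (h2.isBigO_one ℝ).mul hO
  have h4 : Asymptotics.IsBigO Filter.atTop (fun t ↦ HurwitzZeta.evenKernel 0 t ^ n - 1)
      (fun t : ℝ ↦ t ^ r) := by
    simpa only [geom_sum_mul, one_mul] using h3
  have h5 := Complex.isBigO_ofReal_left.mpr h4
  simpa using h5

/-- The FE-pair of the `n`-th power of the theta function. -/
noncomputable def epsteinFEPair (n : ℕ) (hn : 0 < n) : WeakFEPair ℂ where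
  f := fun t ↦ ((HurwitzZeta.evenKernel 0 t ^ n : ℝ) : ℂ)
  g := fun t ↦ ((HurwitzZeta.evenKernel 0 t ^ n : ℝ) : ℂ)
  hf_int := (continuous_ofReal.comp_continuousOn
    ((HurwitzZeta.continuousOn_evenKernel 0).pow n)).locallyIntegrableOn measurableSet_Ioi
  hg_int := (continuous_ofReal.comp_continuousOn
    ((HurwitzZeta.continuousOn_evenKernel 0).pow n)).locallyIntegrableOn measurableSet_Ioi
  k := n / 2
  hk := by positivity
  ε := 1
  hε := one_ne_zero
  f₀ := 1
  g₀ := 1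
  hf_top := epstein_top n
  hg_top := epstein_top n
  h_feq x hx := by
    have hx' : (0 : ℝ) < x := hx
    have h := HurwitzZeta.evenKernel_functional_equation 0 (1 / x)
    rw [← HurwitzZeta.evenKernel_eq_cosKernel_of_zero, one_div_one_div] at h
    rw [h, one_mul, smul_eq_mul, ← ofReal_mul, mul_pow]
    congr 2
    rw [one_div, one_div, Real.inv_rpow hx'.le, inv_inv, ← Real.rpow_natCast,
      ← Real.rpow_mul hx'.le]
    congr 1
    ring

lemma epstein_hasSum_theta (n : ℕ) {t : ℝ} (ht : 0 < t) :
    HasSum (fun k : {k : Fin n → ℤ // k ≠ 0} ↦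
      Real.exp (-Real.pi * (Real.sqrt (∑ i, (((k : Fin n → ℤ) i : ℝ)) ^ 2)) ^ 2 * t))
      (HurwitzZeta.evenKernel 0 t ^ n - 1) := by
  have h1 := HurwitzZeta.hasSum_int_evenKernel 0 ht
  have h2 := epstein_hasSum_prod (fun _ ↦ (Real.exp_pos _).le) h1 n
  have h3 : HasSum (fun k : Fin n → ℤ ↦
      Real.exp (-Real.pi * (Real.sqrt (∑ i, ((k i : ℝ)) ^ 2)) ^ 2 * t))
      (HurwitzZeta.evenKernel 0 t ^ n) := by
    refine HasSum.congr_fun (by simpa using h2) fun k ↦ ?_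
    rw [Real.sq_sqrt (Finset.sum_nonneg fun i _ ↦ sq_nonneg _), ← Real.exp_sum]
    congr 1
    simp [Finset.mul_sum, Finset.sum_mul]
  have h4 := (hasSum_subtype_iff_indicator (s := {k : Fin n → ℤ | k ≠ 0})
    (f := fun k : Fin n → ℤ ↦
      Real.exp (-Real.pi * (Real.sqrt (∑ i, ((k i : ℝ)) ^ 2)) ^ 2 * t))).mpr
    (HasSum.congr_fun (hasSum_ite_sub_hasSum h3 0) fun k ↦ ?_)
  · have h5 : Real.exp (-Real.pi * (Real.sqrt (∑ i, (((0 : Fin n → ℤ) i : ℝ)) ^ 2)) ^ 2 * t)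
        = 1 := by simp
    rw [h5] at h4
    exact h4
  · by_cases hk : k = 0 <;> simp [hk, Set.indicator]

lemma epstein_Λ (n : ℕ) (hn : 0 < n) (s : ℂ) (hs : (n : ℝ) < s.re) :
    (epsteinFEPair n hn).Λ (s / 2) = Gammaℝ s * ∑' k : {k : Fin n → ℤ // k ≠ 0},
          ((Real.sqrt (∑ i, (((k : Fin n → ℤ) i : ℝ)) ^ 2) : ℂ) ^ s)⁻¹ := by
  have hn' : (0 : ℝ) < n := by exact_mod_cast hn
  have hk : (epsteinFEPair n hn).k < (s / 2).re := by
    change (n : ℝ) / 2 < _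
    rw [div_ofNat_re]
    linarith
  rw [← ((epsteinFEPair n hn).hasMellin hk).2, ← tsum_mul_left]
  have hpos : ∀ k : {k : Fin n → ℤ // k ≠ 0},
      0 < Real.sqrt (∑ i, (((k : Fin n → ℤ) i : ℝ)) ^ 2) := by
    rintro ⟨k, hk⟩
    obtain ⟨i, hi⟩ := Function.ne_iff.mp hk
    refine Real.sqrt_pos.mpr (Finset.sum_pos' (fun i _ ↦ sq_nonneg _) ⟨i, Finset.mem_univ _, ?_⟩)
    have : (k i : ℝ) ≠ 0 := by exact_mod_cast hi
    positivity
  have := hasSum_mellin_pi_mul_sq (a := fun _ ↦ 1)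
    (r := fun k : {k : Fin n → ℤ // k ≠ 0} ↦ Real.sqrt (∑ i, (((k : Fin n → ℤ) i : ℝ)) ^ 2))
    (F := fun t ↦ (epsteinFEPair n hn).f t - (epsteinFEPair n hn).f₀) (s := s)
    (hn'.trans hs) ?_ ?_
  · rw [← this.tsum_eq]
    refine tsum_congr fun k ↦ ?_
    rw [abs_of_pos (hpos k), mul_one, div_eq_mul_inv]
  · intro t ht
    have h := epstein_hasSum_theta n ht
    rw [← hasSum_ofReal] at h
    simp only [(hpos _).ne', if_false, one_mul]
    simpa [epsteinFEPair] using h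
  · refine ((epstein_summable n s.re hs).comp_injective Subtype.val_injective).congr fun k ↦ ?_
    simp only [Function.comp_apply]
    rw [Real.rpow_neg (Real.sqrt_nonneg _), abs_of_pos (hpos k), norm_one, one_div]

/-- The Epstein zeta function `Z_n(s) = ∑_{0 ≠ k ∈ ℤⁿ} ‖k‖^{−s}` extends meromorphically
to `ℂ` with a single simple pole at `s = n` of residue `2π^{n/2}/Γ(n/2)`, and `Z_n(0) = −1`. -/
theorem epstein_zeta_continuation (n : ℕ) (hn : 0 < n) :
    ∃ G : ℂ → ℂ, Differentiable ℂ G ∧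
      (∀ s : ℂ, (n : ℝ) < s.re →
        (∑' k : {k : Fin n → ℤ // k ≠ 0},
          ((Real.sqrt (∑ i, (((k : Fin n → ℤ) i : ℝ)) ^ 2) : ℂ) ^ s)⁻¹) =
          G s + ((2 * Real.pi ^ ((n : ℝ) / 2) / Real.Gamma ((n : ℝ) / 2) : ℝ) : ℂ) /
            (s - (n : ℂ))) ∧
      G 0 - ((2 * Real.pi ^ ((n : ℝ) / 2) / Real.Gamma ((n : ℝ) / 2) : ℝ) : ℂ) / (n : ℂ) = -1 := by
  have hn' : (0 : ℝ) < n := by exact_mod_cast hn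
  have hnC : (n : ℂ) ≠ 0 := by exact_mod_cast hn.ne'
  let r : ℂ → ℂ := fun s ↦ (Gammaℝ s)⁻¹
  have hr : Differentiable ℂ r := differentiable_Gammaℝ_inv
  have hres : ((2 * Real.pi ^ ((n : ℝ) / 2) / Real.Gamma ((n : ℝ) / 2) : ℝ) : ℂ)
      = 2 * r n := by
    simp only [r, Gammaℝ_def]
    rw [ofReal_div, ofReal_mul, ofReal_cpow Real.pi_pos.le, ← Complex.Gamma_ofReal]
    push_cast
    rw [neg_div, cpow_neg, mul_inv, inv_inv, div_eq_mul_inv, mul_assoc]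
  have hr0 : r 0 = 0 := by
    simp only [r, inv_eq_zero]
    exact Gammaℝ_eq_zero_iff.mpr ⟨0, by simp⟩
  rw [hres]
  refine ⟨fun s ↦ r s * (epsteinFEPair n hn).Λ₀ (s / 2) - r (s + 2) / Real.pi
    + 2 * dslope r n s, ?_, ?_, ?_⟩
  · have h1 : Differentiable ℂ (dslope r n) := by
      rw [← differentiableOn_univ]
      exact (differentiableOn_dslope Filter.univ_mem).mpr hr.differentiableOn
    have h2 := (epsteinFEPair n hn).differentiable_Λ₀
    have h3 : Differentiable ℂ fun s : ℂ ↦ (epsteinFEPair n hn).Λ₀ (s / 2) :=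
      h2.comp (differentiable_id.div_const 2)
    have h4 : Differentiable ℂ fun s : ℂ ↦ r (s + 2) := hr.comp (differentiable_id.add_const 2)
    exact ((hr.mul h3).sub (h4.div_const _)).add (h1.const_mul 2)
  · intro s hs
    have hs0 : s ≠ 0 := by rintro rfl; simp at hs; linarith
    have hsn : s ≠ n := by rintro rfl; simp at hs
    have hsn' : s - n ≠ 0 := sub_ne_zero.mpr hsn
    have hsn'' : (n : ℂ) - s ≠ 0 := sub_ne_zero.mpr hsn.symm
    have hG : Gammaℝ s ≠ 0 := Gammaℝ_ne_zero_of_re_pos (hn'.trans hs)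
    have h := epstein_Λ n hn s hs
    have hΛ : (epsteinFEPair n hn).Λ (s / 2) =
        (epsteinFEPair n hn).Λ₀ (s / 2) - 2 / s + 2 / (s - n) := by
      rw [WeakFEPair.Λ]
      simp only [epsteinFEPair, smul_eq_mul, mul_one]
      push_cast
      rw [← sub_div, one_div_div, one_div_div, ← neg_sub s (n : ℂ), div_neg, sub_neg_eq_add]
    rw [hΛ] at h
    have hpi : (Real.pi : ℂ) ≠ 0 := by exact_mod_cast Real.pi_ne_zero
    have hr2 : r (s + 2) / Real.pi = r s * (2 / s) := by
      simp only [r, Gammaℝ_add_two hs0]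
      field_simp
    beta_reduce
    rw [hr2, dslope_of_ne _ hsn, slope_def_field]
    have hrs : r s * Gammaℝ s = 1 := inv_mul_cancel₀ hG
    calc _ = r s * (Gammaℝ s * ∑' k : {k : Fin n → ℤ // k ≠ 0},
          ((Real.sqrt (∑ i, (((k : Fin n → ℤ) i : ℝ)) ^ 2) : ℂ) ^ s)⁻¹) := by
            rw [← mul_assoc, hrs, one_mul]
      _ = _ := by
            rw [← h]
            field_simp
            ring
  · have hpi : (Real.pi : ℂ) ≠ 0 := by exact_mod_cast Real.pi_ne_zero
    have h2 : r (0 + 2) / Real.pi = 1 := by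
      simp only [r, Gammaℝ_def, zero_add]
      rw [neg_div, div_self two_ne_zero, Gamma_one, cpow_neg_one]
      field_simp
    simp only [h2]
    rw [dslope_of_ne _ hnC.symm, slope_def_field, hr0]
    field_simp
    ring
end
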